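/- arXiv:1905.12031 — 8 statements merged into one kernel-verified Lean document; each statement's English description precedes it below -/
import Mathlib

section
/- Let Y be a real random variable whose law is the standard Gaussian measure N(0,1), let α₊, α₋ > 0, and set X = α₊·Y·1_{Y>0} + α₋·Y·1_{Y<0}. Then for every integer n ≥ 1, E[Xⁿ] = (2^{n/2}·Γ((n+1)/2)/(2·√π))·(α₊ⁿ + (−1)ⁿ·α₋ⁿ). -/
open MeasureTheory ProbabilityTheory Real Filter

lemma gaussianPDFReal_zero_one_mul_pow (n : ℕ) (x : ℝ) :
    gaussianPDFReal 0 1 x * x ^ n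
      = (√(2 * π))⁻¹ * (x ^ (n : ℝ) * Real.exp (-(1 / 2) * x ^ 2)) := by
  rw [rpow_natCast, gaussianPDFReal]
  simp only [NNReal.coe_one, mul_one, sub_zero]
  ring_nf

lemma integrable_gaussianPDFReal_zero_one_mul_pow (n : ℕ) :
    Integrable fun x : ℝ ↦ gaussianPDFReal 0 1 x * x ^ n := by
  simp_rw [gaussianPDFReal_zero_one_mul_pow]
  exact (integrable_rpow_mul_exp_neg_mul_sq (by norm_num)
    (neg_one_lt_zero.trans_le n.cast_nonneg)).const_mul _

lemma integral_Ioi_gaussianPDFReal_zero_one_mul_pow (n : ℕ) :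
    ∫ x in Set.Ioi (0 : ℝ), gaussianPDFReal 0 1 x * x ^ n
      = (2 : ℝ) ^ ((n : ℝ) / 2) * Real.Gamma (((n : ℝ) + 1) / 2) / (2 * √π) := by
  have h := integral_rpow_mul_exp_neg_mul_rpow (p := 2) (q := n) (b := 1 / 2) two_pos
    (neg_one_lt_zero.trans_le n.cast_nonneg) (by norm_num)
  simp_rw [rpow_two] at h
  have hpow : (1 / 2 : ℝ) ^ (-((n : ℝ) + 1) / 2) = 2 ^ ((n : ℝ) / 2) * √2 := by
    rw [one_div, inv_rpow zero_le_two, ← rpow_neg zero_le_two, sqrt_eq_rpow,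
      ← rpow_add two_pos]
    ring_nf
  simp_rw [gaussianPDFReal_zero_one_mul_pow]
  rw [integral_const_mul, h, hpow, sqrt_mul zero_le_two]
  field_simp

lemma integral_Iic_gaussianPDFReal_zero_one_mul_pow (n : ℕ) :
    ∫ x in Set.Iic (0 : ℝ), gaussianPDFReal 0 1 x * x ^ n
      = (-1) ^ n * ∫ x in Set.Ioi (0 : ℝ), gaussianPDFReal 0 1 x * x ^ n := by
  have h := integral_comp_neg_Ioi 0 fun x : ℝ ↦ gaussianPDFReal 0 1 x * x ^ n
  rw [neg_zero] at h
  rw [← h, ← integral_const_mul]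
  congr with x
  rw [neg_pow x]
  simp only [gaussianPDFReal, sub_zero, neg_sq]
  ring

/-- Lemma 2.2: moments of the oscillating Gaussian process. -/
theorem oscillating_gaussian_moments
    {Ω : Type*} [MeasurableSpace Ω] (P : Measure Ω) [IsProbabilityMeasure P]
    (Y : Ω → ℝ) (hYmeas : Measurable Y)
    (hYlaw : P.map Y = gaussianReal 0 1)
    (αp αm : ℝ) (hαp : 0 < αp) (hαm : 0 < αm)
    (X : Ω → ℝ)
    (hX : ∀ ω, X ω = αp * Y ω * (if 0 < Y ω then (1 : ℝ) else 0)
            + αm * Y ω * (if Y ω < 0 then (1 : ℝ) else 0))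
    (n : ℕ) (hn : 1 ≤ n) :
    ∫ ω, (X ω) ^ n ∂P
      = (2 : ℝ) ^ ((n : ℝ) / 2) * Real.Gamma (((n : ℝ) + 1) / 2) / (2 * Real.sqrt π)
        * (αp ^ n + (-1 : ℝ) ^ n * αm ^ n) := by
  set g : ℝ → ℝ := fun y ↦ αp * y * (if 0 < y then (1 : ℝ) else 0)
    + αm * y * (if y < 0 then (1 : ℝ) else 0) with hg
  have hgmeas : Measurable g :=
    ((measurable_id.const_mul αp).mul
      (Measurable.ite measurableSet_Ioi measurable_const measurable_const)).add
    ((measurable_id.const_mul αm).mul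
      (Measurable.ite measurableSet_Iio measurable_const measurable_const))
  have hIoi : Set.EqOn (fun x ↦ αp ^ n * (gaussianPDFReal 0 1 x * x ^ n))
      (fun x ↦ gaussianPDFReal 0 1 x * g x ^ n) (Set.Ioi 0) := by
    intro x (hx : 0 < x)
    simp only [hg, hx, hx.not_gt, if_true, if_false]
    ring
  have hIic : Set.EqOn (fun x ↦ αm ^ n * (gaussianPDFReal 0 1 x * x ^ n))
      (fun x ↦ gaussianPDFReal 0 1 x * g x ^ n) (Set.Iic 0) := by
    intro x (hx : x ≤ 0)
    rcases hx.eq_or_lt with rfl | hx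
    · simp [hg, Nat.one_le_iff_ne_zero.mp hn]
    · simp only [hg, hx, hx.not_gt, if_true, if_false]
      ring
  have hint := integrable_gaussianPDFReal_zero_one_mul_pow n
  calc ∫ ω, X ω ^ n ∂P
      = ∫ ω, g (Y ω) ^ n ∂P := by simp only [hX, hg]
    _ = ∫ y, g y ^ n ∂gaussianReal 0 1 := by
      rw [← hYlaw, integral_map hYmeas.aemeasurable (hgmeas.pow_const n).aestronglyMeasurable]
    _ = ∫ x, gaussianPDFReal 0 1 x * g x ^ n := by
      simp [integral_gaussianReal_eq_integral_smul one_ne_zero]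
    _ = (∫ x in Set.Iic 0, gaussianPDFReal 0 1 x * g x ^ n)
        + ∫ x in Set.Ioi 0, gaussianPDFReal 0 1 x * g x ^ n :=
      (intervalIntegral.integral_Iic_add_Ioi
        ((hint.const_mul _).integrableOn.congr_fun hIic measurableSet_Iic)
        ((hint.const_mul _).integrableOn.congr_fun hIoi measurableSet_Ioi)).symm
    _ = _ := by
      rw [← setIntegral_congr_fun measurableSet_Iic hIic,
        ← setIntegral_congr_fun measurableSet_Ioi hIoi, integral_const_mul, integral_const_mul,
        integral_Iic_gaussianPDFReal_zero_one_mul_pow,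
        integral_Ioi_gaussianPDFReal_zero_one_mul_pow]
      ring
end

section
/- For every a ∈ (−1, 1) and all nonnegative integers m, n, the integral (1/(2π·√(1−a²)))·∫₀^∞∫₀^∞ xᵐ·yⁿ·exp(−(x² + y² − 2axy)/(2(1−a²))) dx dy equals 2^{(n+m−4)/2}·π^{−1}·(1−a²)^{(n+m+1)/2}·Σ_{r=0}^∞ ((2a)^r / r!)·Γ((n+r+1)/2)·Γ((m+r+1)/2), and the series on the right-hand side converges absolutely. -/
open MeasureTheory Real

/-- Half-line Gaussian moments of natural order. -/
lemma integral_Ioi_pow_mul_exp_neg_mul_sq {b : ℝ} (hb : 0 < b) (k : ℕ) :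
    ∫ x in Set.Ioi (0 : ℝ), x ^ k * exp (-b * x ^ 2)
      = b ^ (-((k : ℝ) + 1) / 2) * (1 / 2) * Gamma (((k : ℝ) + 1) / 2) := by
  have hk : (-1 : ℝ) < k := by linarith [k.cast_nonneg (α := ℝ)]
  have h := integral_rpow_mul_exp_neg_mul_rpow two_pos hk hb
  simpa only [rpow_natCast, rpow_two] using h

lemma integrableOn_Ioi_pow_mul_exp_neg_mul_sq {b : ℝ} (hb : 0 < b) (k : ℕ) :
    IntegrableOn (fun x : ℝ => x ^ k * exp (-b * x ^ 2)) (Set.Ioi 0) := by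
  have hk : (-1 : ℝ) < k := by linarith [k.cast_nonneg (α := ℝ)]
  simpa only [rpow_natCast] using integrableOn_rpow_mul_exp_neg_mul_sq hb hk

/-- On the positive quadrant, a monomial times `exp (c * x * y - b * (x ^ 2 + y ^ 2))` is
integrable as soon as `c < 2 * b`. -/
lemma integrable_quadrant_pow_mul_exp {b c : ℝ} (hb : 0 < b) (hc : c < 2 * b) (m n : ℕ) :
    Integrable (fun p : ℝ × ℝ =>
        p.1 ^ m * exp (-b * p.1 ^ 2) * (p.2 ^ n * exp (-b * p.2 ^ 2)) * exp (c * (p.1 * p.2)))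
      ((volume.restrict (Set.Ioi (0 : ℝ))).prod (volume.restrict (Set.Ioi (0 : ℝ)))) := by
  obtain ⟨d, hd, hdb, hcd⟩ : ∃ d, 0 < d ∧ d ≤ b ∧ c ≤ 2 * (b - d) :=
    ⟨min b (b - c / 2), lt_min hb (by linarith), min_le_left _ _,
      by linarith [min_le_right b (b - c / 2)]⟩
  refine ((integrableOn_Ioi_pow_mul_exp_neg_mul_sq hd m).integrable.mul_prod
    (integrableOn_Ioi_pow_mul_exp_neg_mul_sq hd n).integrable).mono'
    (by fun_prop) ?_
  rw [Measure.prod_restrict]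
  filter_upwards [ae_restrict_mem (measurableSet_Ioi.prod measurableSet_Ioi)] with p hp
  obtain ⟨hx, hy⟩ : 0 < p.1 ∧ 0 < p.2 := hp
  rw [norm_of_nonneg (by positivity)]
  calc p.1 ^ m * exp (-b * p.1 ^ 2) * (p.2 ^ n * exp (-b * p.2 ^ 2)) * exp (c * (p.1 * p.2))
      = p.1 ^ m * p.2 ^ n * exp (-b * p.1 ^ 2 + -b * p.2 ^ 2 + c * (p.1 * p.2)) := by
        rw [exp_add, exp_add]; ring
    _ ≤ p.1 ^ m * p.2 ^ n * exp (-d * p.1 ^ 2 + -d * p.2 ^ 2) := by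
        refine mul_le_mul_of_nonneg_left (exp_le_exp.2 ?_) (by positivity)
        nlinarith [mul_nonneg (sub_nonneg.2 hdb) (sq_nonneg (p.1 - p.2)),
          mul_le_mul_of_nonneg_right hcd (mul_pos hx hy).le]
    _ = p.1 ^ m * exp (-d * p.1 ^ 2) * (p.2 ^ n * exp (-d * p.2 ^ 2)) := by
        rw [exp_add]; ring

/-- Termwise integration over the positive quadrant of the exponential series of the cross term
`exp (c * x * y)` against a Gaussian weight. -/
lemma hasSum_integral_quadrant_pow_mul_exp {b c : ℝ} (hb : 0 < b) (hc : |c| < 2 * b) (m n : ℕ) :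
    HasSum (fun r : ℕ => c ^ r / (r.factorial : ℝ) *
        ((∫ x in Set.Ioi (0 : ℝ), x ^ (m + r) * exp (-b * x ^ 2)) *
          ∫ y in Set.Ioi (0 : ℝ), y ^ (n + r) * exp (-b * y ^ 2)))
      (∫ x in Set.Ioi (0 : ℝ), ∫ y in Set.Ioi (0 : ℝ),
        x ^ m * exp (-b * x ^ 2) * (y ^ n * exp (-b * y ^ 2)) * exp (c * (x * y))) := by
  rw [← integral_prod _ (integrable_quadrant_pow_mul_exp hb (le_abs_self c |>.trans_lt hc) m n)]
  simp_rw [← integral_prod_mul (μ := volume.restrict (Set.Ioi (0 : ℝ)))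
    (ν := volume.restrict (Set.Ioi (0 : ℝ))), ← integral_const_mul]
  have hexp (t : ℝ) : HasSum (fun r : ℕ => t ^ r / (r.factorial : ℝ)) (exp t) := by
    rw [exp_eq_exp_ℝ]
    exact NormedSpace.expSeries_div_hasSum_exp t
  have hseries (t : ℝ) (p : ℝ × ℝ) :
      HasSum (fun r : ℕ => t ^ r / (r.factorial : ℝ) *
          (p.1 ^ (m + r) * exp (-b * p.1 ^ 2) * (p.2 ^ (n + r) * exp (-b * p.2 ^ 2))))
        (p.1 ^ m * exp (-b * p.1 ^ 2) * (p.2 ^ n * exp (-b * p.2 ^ 2)) *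
          exp (t * (p.1 * p.2))) := by
    refine ((hexp (t * (p.1 * p.2))).mul_left _).congr_fun fun r => ?_
    rw [mul_pow, mul_pow, pow_add, pow_add]
    ring
  refine hasSum_integral_of_dominated_convergence
    (fun r p => |c| ^ r / (r.factorial : ℝ) *
      (p.1 ^ (m + r) * exp (-b * p.1 ^ 2) * (p.2 ^ (n + r) * exp (-b * p.2 ^ 2))))
    (fun r => by fun_prop) (fun r => ?_) (.of_forall fun p => (hseries |c| p).summable) ?_
    (.of_forall fun p => hseries c p)
  · rw [Measure.prod_restrict]
    filter_upwards [ae_restrict_mem (measurableSet_Ioi.prod measurableSet_Ioi)] with p hp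
    obtain ⟨hx, hy⟩ : 0 < p.1 ∧ 0 < p.2 := hp
    rw [norm_mul, norm_div, norm_pow, norm_eq_abs c, norm_of_nonneg (Nat.cast_nonneg r.factorial),
      norm_of_nonneg (by positivity)]
  · simp_rw [fun p => (hseries |c| p).tsum_eq]
    exact integrable_quadrant_pow_mul_exp hb hc m n

/-- Lemma 2.4: the positive-orthant mixed moment of a standard bivariate Gaussian
with correlation `a`, expressed as an absolutely convergent series. -/
theorem bivariate_gaussian_positive_orthant_moment
    (a : ℝ) (ha : a ∈ Set.Ioo (-1 : ℝ) 1) (m n : ℕ) :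
    Summable (fun r : ℕ =>
      |((2 * a) ^ r / (r.factorial : ℝ))
        * Real.Gamma (((n : ℝ) + (r : ℝ) + 1) / 2)
        * Real.Gamma (((m : ℝ) + (r : ℝ) + 1) / 2)|)
    ∧ (1 / (2 * π * Real.sqrt (1 - a ^ 2)))
        * (∫ x in Set.Ioi (0 : ℝ), ∫ y in Set.Ioi (0 : ℝ),
            x ^ m * y ^ n * Real.exp (-(x ^ 2 + y ^ 2 - 2 * a * x * y) / (2 * (1 - a ^ 2))))
      = (2 : ℝ) ^ (((n : ℝ) + (m : ℝ) - 4) / 2) * π⁻¹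
          * (1 - a ^ 2) ^ (((n : ℝ) + (m : ℝ) + 1) / 2)
          * ∑' r : ℕ, ((2 * a) ^ r / (r.factorial : ℝ))
              * Real.Gamma (((n : ℝ) + (r : ℝ) + 1) / 2)
              * Real.Gamma (((m : ℝ) + (r : ℝ) + 1) / 2) := by
  obtain ⟨ha₁, ha₂⟩ := ha
  have hD : 0 < 1 - a ^ 2 := by nlinarith
  set D := 1 - a ^ 2
  have hb : 0 < (2 * D)⁻¹ := by positivity
  have hc : |a / D| < 2 * (2 * D)⁻¹ := by
    rw [abs_div, abs_of_pos hD, mul_inv, mul_inv_cancel_left₀ two_ne_zero, div_eq_mul_inv]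
    exact mul_lt_of_lt_one_left (by positivity) (abs_lt.2 ⟨ha₁, ha₂⟩)
  have hsum := hasSum_integral_quadrant_pow_mul_exp hb hc m n
  have hterm (r : ℕ) :
      (a / D) ^ r / (r.factorial : ℝ) *
        ((∫ x in Set.Ioi (0 : ℝ), x ^ (m + r) * exp (-(2 * D)⁻¹ * x ^ 2)) *
          ∫ y in Set.Ioi (0 : ℝ), y ^ (n + r) * exp (-(2 * D)⁻¹ * y ^ 2))
      = (2 * D) ^ (((n : ℝ) + m) / 2 + 1) / 4 *
        ((2 * a) ^ r / (r.factorial : ℝ) * Gamma (((n : ℝ) + r + 1) / 2)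
          * Gamma (((m : ℝ) + r + 1) / 2)) := by
    have hpow : (2 * D)⁻¹ ^ (-(((m + r : ℕ) : ℝ) + 1) / 2) *
        (2 * D)⁻¹ ^ (-(((n + r : ℕ) : ℝ) + 1) / 2)
        = (2 * D) ^ (((n : ℝ) + m) / 2 + 1) * (2 * D) ^ r := by
      rw [← rpow_add hb, inv_rpow (by positivity), ← rpow_neg (by positivity), ← rpow_natCast,
        ← rpow_add (by positivity)]
      congr 1
      push_cast
      ring
    have hratio : (a / D) ^ r * (2 * D) ^ r = (2 * a) ^ r := by
      rw [← mul_pow]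
      congr 1
      field_simp
    rw [integral_Ioi_pow_mul_exp_neg_mul_sq hb, integral_Ioi_pow_mul_exp_neg_mul_sq hb, ← hratio]
    push_cast at hpow ⊢
    linear_combination (a / D) ^ r / (r.factorial : ℝ) / 4 * Gamma (((n : ℝ) + r + 1) / 2)
          * Gamma (((m : ℝ) + r + 1) / 2) * hpow
  have hconst : 0 < (2 * D) ^ (((n : ℝ) + m) / 2 + 1) / 4 := by positivity
  simp_rw [hterm] at hsum
  refine ⟨((summable_mul_left_iff hconst.ne').1 hsum.summable).abs, ?_⟩
  have hint : (∫ x in Set.Ioi (0 : ℝ), ∫ y in Set.Ioi (0 : ℝ),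
        x ^ m * y ^ n * exp (-(x ^ 2 + y ^ 2 - 2 * a * x * y) / (2 * D)))
      = ∫ x in Set.Ioi (0 : ℝ), ∫ y in Set.Ioi (0 : ℝ),
        x ^ m * exp (-(2 * D)⁻¹ * x ^ 2) * (y ^ n * exp (-(2 * D)⁻¹ * y ^ 2)) *
          exp (a / D * (x * y)) := by
    congr! 4 with x y
    rw [show -(x ^ 2 + y ^ 2 - 2 * a * x * y) / (2 * D)
      = -(2 * D)⁻¹ * x ^ 2 + -(2 * D)⁻¹ * y ^ 2 + a / D * (x * y) by field_simp; ring,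
      exp_add, exp_add]
    ring
  rw [hint, ← hsum.tsum_eq, tsum_mul_left, ← mul_assoc]
  congr 1
  have h2 : (2 : ℝ) ^ (((n : ℝ) + m) / 2 + 1) = 2 ^ (((n : ℝ) + m - 4) / 2) * 8 := by
    rw [show (8 : ℝ) = 2 ^ (3 : ℝ) by norm_num, ← rpow_add two_pos]
    congr 1
    ring
  have hDpow : D ^ (((n : ℝ) + m) / 2 + 1) = D ^ (((n : ℝ) + m + 1) / 2) * √D := by
    rw [sqrt_eq_rpow, ← rpow_add hD]
    congr 1
    ring
  have hsqrt : √D ≠ 0 := (sqrt_pos.2 hD).ne'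
  rw [mul_rpow two_pos.le hD.le, h2, hDpow]
  field_simp
  norm_num
end

section
/- Let α₊, α₋ > 0, let f(y) = α₊·y·1_{y>0} + α₋·y·1_{y<0}, and fix an integer n ≥ 1. For a ∈ (−1, 1), let K_n(a) = (1/(2π·√(1−a²)))·∫_{ℝ}∫_{ℝ} f(x)ⁿ·f(y)ⁿ·exp(−(x² + y² − 2axy)/(2(1−a²))) dx dy, and let μ_n = (2^{n/2}·Γ((n+1)/2)/(2·√π))·(α₊ⁿ + (−1)ⁿ·α₋ⁿ). Then there exist constants C > 0 and δ ∈ (0, 1) such that for all a with |a| ≤ δ, |K_n(a) − μ_n²| ≤ C·|a|. -/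
open MeasureTheory Real

lemma abs_exp_sub_one_le_abs_mul_exp_abs (t : ℝ) : |exp t - 1| ≤ |t| * exp |t| := by
  rcases le_total 0 t with h | h
  · have h1 := add_one_le_exp (-t)
    have h2 : exp t * exp (-t) = 1 := by rw [← exp_add]; simp
    rw [abs_of_nonneg h, abs_of_nonneg (by linarith [add_one_le_exp t])]
    nlinarith [exp_pos t]
  · have h1 := add_one_le_exp t
    have h2 : 1 ≤ exp (-t) := one_le_exp (by linarith)
    rw [abs_of_nonpos h, abs_of_nonpos (by linarith [exp_le_one_iff.2 h])]
    nlinarith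

lemma integrable_abs_pow_mul_exp_neg_mul_sq (k : ℕ) {b : ℝ} (hb : 0 < b) :
    Integrable fun u : ℝ => |u| ^ k * exp (-b * u ^ 2) := by
  have h := (integrable_rpow_mul_exp_neg_mul_sq hb
    (show (-1 : ℝ) < k by linarith [Nat.cast_nonneg (α := ℝ) k])).norm
  refine h.congr (Filter.Eventually.of_forall fun u => ?_)
  simp [abs_of_pos (exp_pos _)]

lemma exp_half_sq_add_mul_le {a u v : ℝ} (ha : |a| ≤ 1 / 2) :
    exp (-(u ^ 2 + v ^ 2) / 2) * exp |a * u * v|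
      ≤ exp (-(1 / 4) * u ^ 2) * exp (-(1 / 4) * v ^ 2) := by
  rw [← exp_add, ← exp_add, exp_le_exp, abs_mul, abs_mul]
  have h1 : |a| * (|u| * |v|) ≤ 1 / 2 * (|u| * |v|) :=
    mul_le_mul_of_nonneg_right ha (by positivity)
  nlinarith [sq_nonneg (|u| - |v|), sq_abs u, sq_abs v]

lemma measurable_gaussian_kernel {h : ℝ → ℝ} (hm : Measurable h) (a : ℝ) :
    Measurable fun z : ℝ × ℝ =>
      h z.1 * h z.2 * exp (-(z.1 ^ 2 + z.2 ^ 2) / 2 + a * z.1 * z.2) := by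
  have h1 : Measurable fun z : ℝ × ℝ => h z.1 := hm.comp measurable_fst
  have h2 : Measurable fun z : ℝ × ℝ => h z.2 := hm.comp measurable_snd
  exact (h1.mul h2).mul (by fun_prop)

lemma integrable_gaussian_kernel {h : ℝ → ℝ} (hm : Measurable h) {A : ℝ} {n : ℕ}
    (hA : ∀ u, |h u| ≤ A * |u| ^ n) {a : ℝ} (ha : |a| ≤ 1 / 2) :
    Integrable fun z : ℝ × ℝ =>
      h z.1 * h z.2 * exp (-(z.1 ^ 2 + z.2 ^ 2) / 2 + a * z.1 * z.2) := by
  have hg := (integrable_abs_pow_mul_exp_neg_mul_sq n (b := 1 / 4) (by norm_num)).const_mul A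
  refine (hg.mul_prod hg).mono' (measurable_gaussian_kernel hm a).aestronglyMeasurable
    (Filter.Eventually.of_forall fun z => ?_)
  obtain ⟨u, v⟩ := z
  simp only [norm_eq_abs, abs_mul, abs_exp]
  calc |h u| * |h v| * exp (-(u ^ 2 + v ^ 2) / 2 + a * u * v)
      ≤ (A * |u| ^ n) * (A * |v| ^ n) *
          (exp (-(1 / 4) * u ^ 2) * exp (-(1 / 4) * v ^ 2)) := by
        have hu := hA u
        have hv := hA v
        have hu0 := (abs_nonneg _).trans hu
        refine mul_le_mul (mul_le_mul hu hv (abs_nonneg _) hu0) ?_ (by positivity)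
          (mul_nonneg hu0 ((abs_nonneg _).trans hv))
        refine le_trans ?_ (exp_half_sq_add_mul_le ha)
        rw [exp_add]
        gcongr
        exact le_abs_self _
    _ = _ := by ring

/-- A measurable function of polynomial growth, applied to both coordinates of a Gaussian pair,
has a mixed moment that is Lipschitz at zero correlation (up to normalization). -/
lemma exists_abs_gaussian_kernel_integral_sub_le {h : ℝ → ℝ} (hm : Measurable h) {A : ℝ} {n : ℕ}
    (hA : ∀ u, |h u| ≤ A * |u| ^ n) :
    ∃ C : ℝ, 0 ≤ C ∧ ∀ a : ℝ, |a| ≤ 1 / 2 →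
      |(∫ u : ℝ, ∫ v : ℝ, h u * h v * exp (-(u ^ 2 + v ^ 2) / 2 + a * u * v))
        - (∫ u : ℝ, h u * exp (-(1 / 2) * u ^ 2)) ^ 2| ≤ C * |a| := by
  set g : ℝ → ℝ := fun u => A * (|u| ^ (n + 1) * exp (-(1 / 4) * u ^ 2)) with hgdef
  have hg : Integrable g :=
    (integrable_abs_pow_mul_exp_neg_mul_sq (n + 1) (b := 1 / 4) (by norm_num)).const_mul A
  refine ⟨(∫ u, g u) ^ 2, sq_nonneg _, fun a ha => ?_⟩
  have h0 : (∫ u : ℝ, h u * exp (-(1 / 2) * u ^ 2)) ^ 2 =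
      ∫ z : ℝ × ℝ, h z.1 * h z.2 * exp (-(z.1 ^ 2 + z.2 ^ 2) / 2 + 0 * z.1 * z.2) := by
    rw [sq, ← integral_prod_mul]
    refine integral_congr_ae (Filter.Eventually.of_forall fun z => ?_)
    have : exp (-(z.1 ^ 2 + z.2 ^ 2) / 2 + 0 * z.1 * z.2) =
        exp (-(1 / 2) * z.1 ^ 2) * exp (-(1 / 2) * z.2 ^ 2) := by
      rw [← exp_add]; congr 1; ring
    simp only [this]
    ring
  have hi := integrable_gaussian_kernel hm hA ha
  have hi0 := integrable_gaussian_kernel hm hA (a := 0) (by norm_num)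
  have h1 := integral_prod _ hi
  simp only at h1
  rw [h0, ← h1]
  rw [← Measure.volume_eq_prod, ← integral_sub hi hi0, mul_comm, sq, ← integral_prod_mul,
    ← integral_const_mul, ← norm_eq_abs]
  refine norm_integral_le_of_norm_le ((hg.mul_prod hg).const_mul _)
    (Filter.Eventually.of_forall fun z => ?_)
  obtain ⟨u, v⟩ := z
  have he : h u * h v * exp (-(u ^ 2 + v ^ 2) / 2 + a * u * v)
      - h u * h v * exp (-(u ^ 2 + v ^ 2) / 2 + 0 * u * v) =
      h u * h v * (exp (-(u ^ 2 + v ^ 2) / 2) * (exp (a * u * v) - 1)) := by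
    rw [exp_add, exp_add]; simp; ring
  simp only [norm_eq_abs, hgdef]
  rw [he, abs_mul, abs_mul, abs_mul, abs_exp]
  calc |h u| * |h v| * (exp (-(u ^ 2 + v ^ 2) / 2) * |exp (a * u * v) - 1|)
      ≤ (A * |u| ^ n) * (A * |v| ^ n) *
          (|a * u * v| * (exp (-(1 / 4) * u ^ 2) * exp (-(1 / 4) * v ^ 2))) := by
        have hu := hA u
        have hv := hA v
        have hu0 := (abs_nonneg _).trans hu
        refine mul_le_mul (mul_le_mul hu hv (abs_nonneg _) hu0) ?_ (by positivity)
          (mul_nonneg hu0 ((abs_nonneg _).trans hv))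
        calc exp (-(u ^ 2 + v ^ 2) / 2) * |exp (a * u * v) - 1|
            ≤ exp (-(u ^ 2 + v ^ 2) / 2) * (|a * u * v| * exp |a * u * v|) := by
              gcongr
              exact abs_exp_sub_one_le_abs_mul_exp_abs _
          _ = |a * u * v| * (exp (-(u ^ 2 + v ^ 2) / 2) * exp |a * u * v|) := by ring
          _ ≤ _ := mul_le_mul_of_nonneg_left (exp_half_sq_add_mul_le ha) (abs_nonneg _)
    _ = _ := by rw [abs_mul, abs_mul]; ring

/-- Rescaling both variables by `√(1 - a²)` for a positively homogeneous function. -/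
lemma gaussian_kernel_integral_rescale {h : ℝ → ℝ} {n : ℕ}
    (hh : ∀ s u : ℝ, 0 < s → h (s * u) = s ^ n * h u) {s a : ℝ} (hs : 0 < s)
    (hsa : s ^ 2 = 1 - a ^ 2) :
    (∫ x : ℝ, ∫ y : ℝ,
        h x * h y * exp (-(x ^ 2 + y ^ 2 - 2 * a * x * y) / (2 * (1 - a ^ 2)))) =
      s ^ (2 * n + 2) *
        ∫ u : ℝ, ∫ v : ℝ, h u * h v * exp (-(u ^ 2 + v ^ 2) / 2 + a * u * v) := by
  have scale (F : ℝ → ℝ) : ∫ x, F x = s * ∫ u, F (s * u) := by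
    rw [Measure.integral_comp_mul_left, abs_of_pos (inv_pos.2 hs), smul_eq_mul,
      mul_inv_cancel_left₀ hs.ne']
  rw [scale, ← integral_const_mul, ← integral_const_mul]
  congr 1
  ext u
  rw [scale, ← integral_const_mul, ← integral_const_mul, ← integral_const_mul]
  congr 1
  ext v
  have he : -((s * u) ^ 2 + (s * v) ^ 2 - 2 * a * (s * u) * (s * v)) / (2 * (1 - a ^ 2)) =
      -(u ^ 2 + v ^ 2) / 2 + a * u * v := by
    rw [← hsa]
    field_simp
    ring
  rw [he, hh s u hs, hh s v hs]
  ring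

lemma integral_Ioi_pow_mul_exp_neg_half_sq (n : ℕ) :
    ∫ u in Set.Ioi (0 : ℝ), u ^ n * exp (-(1 / 2) * u ^ 2) =
      (2 : ℝ) ^ ((n : ℝ) / 2) * Gamma (((n : ℝ) + 1) / 2) / √2 := by
  have h := integral_rpow_mul_exp_neg_mul_rpow (p := 2) (q := n) (b := 1 / 2) (by norm_num)
    (by linarith [Nat.cast_nonneg (α := ℝ) n]) (by norm_num)
  simp only [rpow_natCast, rpow_ofNat] at h
  rw [h, one_div, inv_rpow (by norm_num), ← rpow_neg (by norm_num),
    show -(-((n : ℝ) + 1) / 2) = (n : ℝ) / 2 + 1 / 2 by ring, rpow_add (by norm_num),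
    ← sqrt_eq_rpow]
  have h2 : √2 * √2 = (2 : ℝ) := mul_self_sqrt (by norm_num)
  field_simp
  linear_combination (1 : ℝ) * h2

lemma one_sub_le_sqrt_pow {a : ℝ} (ha : |a| ≤ 1) (n : ℕ) :
    1 - (n + 1) * |a| ≤ √(1 - a ^ 2) ^ (2 * n + 1) := by
  have h1 : a ^ 2 ≤ |a| := by rw [← sq_abs]; nlinarith [abs_nonneg a]
  have h2 : 0 ≤ 1 - a ^ 2 := by linarith
  calc (1 : ℝ) - (n + 1) * |a| ≤ 1 + ((n + 1 : ℕ) : ℝ) * (-a ^ 2) := by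
        push_cast
        nlinarith [Nat.cast_nonneg (α := ℝ) n]
    _ ≤ (1 + -a ^ 2) ^ (n + 1) := one_add_mul_le_pow (by linarith) _
    _ = √(1 - a ^ 2) ^ (2 * n + 2) := by
        rw [show 2 * n + 2 = 2 * (n + 1) by ring, pow_mul, sq_sqrt h2]; ring
    _ ≤ _ := pow_le_pow_of_le_one (sqrt_nonneg _) (sqrt_le_one.2 (by nlinarith)) (by omega)

/-- Corollary 2.6: `Cov(X_tⁿ, X_sⁿ) = O(|a|)` where `a` is the correlation of the
driving bivariate Gaussian vector and `X = f(N)` for the oscillating transformation `f`. -/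
theorem oscillating_gaussian_covariance_asymp
    (αp αm : ℝ) (hαp : 0 < αp) (hαm : 0 < αm)
    (f : ℝ → ℝ)
    (hf : ∀ y, f y = αp * y * (if 0 < y then (1 : ℝ) else 0)
            + αm * y * (if y < 0 then (1 : ℝ) else 0))
    (n : ℕ) (hn : 1 ≤ n)
    (μn : ℝ)
    (hμn : μn = (2 : ℝ) ^ ((n : ℝ) / 2) * Real.Gamma (((n : ℝ) + 1) / 2)
              / (2 * Real.sqrt π) * (αp ^ n + (-1 : ℝ) ^ n * αm ^ n)) :
    ∃ C : ℝ, 0 < C ∧ ∃ δ ∈ Set.Ioo (0 : ℝ) 1, ∀ a : ℝ, |a| ≤ δ →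
      |(1 / (2 * π * Real.sqrt (1 - a ^ 2)))
          * (∫ x : ℝ, ∫ y : ℝ,
              (f x) ^ n * (f y) ^ n
                * Real.exp (-(x ^ 2 + y ^ 2 - 2 * a * x * y) / (2 * (1 - a ^ 2))))
        - μn ^ 2|
      ≤ C * |a| := by
  have hpos : ∀ y, 0 < y → f y = αp * y := fun y hy => by
    rw [hf]; simp [hy, hy.le]
  have hneg : ∀ y, y < 0 → f y = αm * y := fun y hy => by
    rw [hf]; simp [hy, hy.le]
  have hzero : f 0 = 0 := by rw [hf]; simp
  have hm : Measurable fun y => f y ^ n := by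
    rw [funext hf]
    refine Measurable.pow_const (Measurable.add ?_ ?_) n
    · exact (measurable_id.const_mul αp).mul
        (Measurable.ite measurableSet_Ioi measurable_const measurable_const)
    · exact (measurable_id.const_mul αm).mul
        (Measurable.ite measurableSet_Iio measurable_const measurable_const)
  have hA : ∀ u, |f u ^ n| ≤ (αp + αm) ^ n * |u| ^ n := by
    intro u
    rw [abs_pow, ← mul_pow]
    gcongr
    rcases lt_trichotomy u 0 with hu | hu | hu
    · rw [hneg u hu, abs_mul, abs_of_pos hαm]
      gcongr
      linarith
    · simp [hu, hzero]
    · rw [hpos u hu, abs_mul, abs_of_pos hαp]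
      gcongr
      linarith
  have hh : ∀ s u : ℝ, 0 < s → f (s * u) ^ n = s ^ n * f u ^ n := by
    intro s u hs
    rw [← mul_pow]
    congr 1
    rcases lt_trichotomy u 0 with hu | hu | hu
    · rw [hneg u hu, hneg _ (mul_neg_of_pos_of_neg hs hu)]; ring
    · simp [hu, hzero]
    · rw [hpos u hu, hpos _ (mul_pos hs hu)]; ring
  have hI : Integrable fun u => f u ^ n * exp (-(1 / 2) * u ^ 2) := by
    refine ((integrable_abs_pow_mul_exp_neg_mul_sq n (b := 1 / 2) (by norm_num)).const_mul
      ((αp + αm) ^ n)).mono' (hm.mul (by fun_prop)).aestronglyMeasurable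
      (Filter.Eventually.of_forall fun u => ?_)
    rw [norm_eq_abs, abs_mul, abs_exp, ← mul_assoc]
    gcongr
    exact hA u
  have hright : ∫ u in Set.Ioi (0 : ℝ), f u ^ n * exp (-(1 / 2) * u ^ 2) =
      αp ^ n * ∫ u in Set.Ioi (0 : ℝ), u ^ n * exp (-(1 / 2) * u ^ 2) := by
    rw [← integral_const_mul]
    refine setIntegral_congr_fun measurableSet_Ioi fun u hu => ?_
    simp only [hpos u hu]
    ring
  have hleft : ∫ u in Set.Iic (0 : ℝ), f u ^ n * exp (-(1 / 2) * u ^ 2) =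
      (-1) ^ n * αm ^ n * ∫ u in Set.Ioi (0 : ℝ), u ^ n * exp (-(1 / 2) * u ^ 2) := by
    rw [← neg_zero, ← integral_comp_neg_Ioi, ← integral_const_mul, neg_zero]
    refine setIntegral_congr_fun measurableSet_Ioi fun u hu => ?_
    have hu' : (0 : ℝ) < u := hu
    simp only [hneg (-u) (by linarith), neg_sq]
    rw [show αm * -u = -1 * αm * u by ring, mul_pow, mul_pow]
    ring
  set G := ∫ u : ℝ, f u ^ n * exp (-(1 / 2) * u ^ 2) with hG
  have hGμ : G ^ 2 / (2 * π) = μn ^ 2 := by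
    have h2 : √2 ^ 2 = (2 : ℝ) := sq_sqrt (by norm_num)
    have h3 : √π ^ 2 = π := sq_sqrt pi_pos.le
    rw [hG, ← intervalIntegral.integral_Iic_add_Ioi (b := 0) hI.integrableOn hI.integrableOn,
      hright, hleft, integral_Ioi_pow_mul_exp_neg_half_sq, hμn, ← add_mul]
    simp only [mul_pow, div_pow, h2, h3]
    have := pi_pos
    field_simp
    ring
  obtain ⟨C, hC0, hC⟩ := exists_abs_gaussian_kernel_integral_sub_le hm hA
  refine ⟨C / (2 * π) + (n + 1) * μn ^ 2 + 1, by positivity, 1 / 2, by norm_num, fun a ha => ?_⟩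
  have ha2 : a ^ 2 ≤ 1 / 4 := by rw [← sq_abs]; nlinarith [abs_nonneg a]
  have hs : 0 < √(1 - a ^ 2) := sqrt_pos.2 (by linarith)
  have hs1 : √(1 - a ^ 2) ≤ 1 := sqrt_le_one.2 (by nlinarith)
  rw [gaussian_kernel_integral_rescale hh hs (sq_sqrt (by linarith))]
  have hca := one_sub_le_sqrt_pow (ha.trans (by norm_num)) n
  have hc1 : √(1 - a ^ 2) ^ (2 * n + 1) ≤ 1 := pow_le_one₀ hs.le hs1
  have hc0 : 0 ≤ √(1 - a ^ 2) ^ (2 * n + 1) := by positivity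
  have hCa := hC a ha
  set J := ∫ u : ℝ, ∫ v : ℝ, f u ^ n * f v ^ n * exp (-(u ^ 2 + v ^ 2) / 2 + a * u * v)
  have hpi := pi_pos
  have hdecomp : 1 / (2 * π * √(1 - a ^ 2)) * (√(1 - a ^ 2) ^ (2 * n + 2) * J) - μn ^ 2 =
      √(1 - a ^ 2) ^ (2 * n + 1) * ((J - G ^ 2) / (2 * π))
        - (1 - √(1 - a ^ 2) ^ (2 * n + 1)) * μn ^ 2 := by
    rw [← hGμ]
    field_simp
    ring
  rw [hdecomp]
  set c := √(1 - a ^ 2) ^ (2 * n + 1)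
  calc |c * ((J - G ^ 2) / (2 * π)) - (1 - c) * μn ^ 2|
      ≤ |c * ((J - G ^ 2) / (2 * π))| + |(1 - c) * μn ^ 2| := abs_sub _ _
    _ = c * (|J - G ^ 2| / (2 * π)) + (1 - c) * μn ^ 2 := by
        rw [abs_mul, abs_mul, abs_div, abs_of_nonneg hc0, abs_of_nonneg (sub_nonneg.2 hc1),
          abs_of_pos (by positivity : 0 < 2 * π), abs_of_nonneg (sq_nonneg μn)]
    _ ≤ 1 * (C * |a| / (2 * π)) + ((n + 1) * |a|) * μn ^ 2 := by
        gcongr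
        linarith
    _ ≤ (C / (2 * π) + (n + 1) * μn ^ 2 + 1) * |a| := by
        have : C * |a| / (2 * π) = C / (2 * π) * |a| := by ring
        nlinarith [abs_nonneg a]
end

section
/- Let (Ω, F, P) be a probability space and Y = (Y_t)_{t≥0} a jointly measurable real-valued stochastic process such that there is an even function r : ℝ → ℝ with r(0) = 1 and, for all s, t ≥ 0 and all c, d ∈ ℝ, the random variable c·Y_s + d·Y_t is centered Gaussian with variance c² + d² + 2cd·r(t − s). Assume r(T) → 0 as T → ∞. Let α₊, α₋ > 0 and X_t = α₊·Y_t·1_{Y_t>0} + α₋·Y_t·1_{Y_t<0}. Then for every integer n ≥ 1 and every p ≥ 1, E[ |(1/T)·∫₀^T X_uⁿ du − μ_n|^p ] → 0 as T → ∞, where μ_n = (2^{n/2}·Γ((n+1)/2)/(2·√π))·(α₊ⁿ + (−1)ⁿ·α₋ⁿ). -/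
open MeasureTheory ProbabilityTheory Real Filter Set

lemma abs_oscillating_le (a b y : ℝ) :
    |a * max y 0 - b * max (-y) 0| ≤ (|a| + |b|) * |y| := by
  have h1 : |max y 0| ≤ |y| := by
    rw [abs_of_nonneg (le_max_right _ _)]
    exact max_le (le_abs_self _) (abs_nonneg _)
  have h2 : |max (-y) 0| ≤ |y| := by
    rw [abs_of_nonneg (le_max_right _ _)]
    exact max_le (neg_le_abs _) (abs_nonneg _)
  refine (abs_sub _ _).trans ?_
  rw [abs_mul, abs_mul, add_mul]
  exact add_le_add (mul_le_mul_of_nonneg_left h1 (abs_nonneg _))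
    (mul_le_mul_of_nonneg_left h2 (abs_nonneg _))

lemma exists_growth_bound_oscillating_pow_sub (a b m : ℝ) (n : ℕ) :
    ∃ C : ℝ, ∀ y : ℝ, |(a * max y 0 - b * max (-y) 0) ^ n - m| ≤ C * (1 + |y| ^ n) := by
  refine ⟨(|a| + |b|) ^ n + |m|, fun y => ?_⟩
  have h4 : |(a * max y 0 - b * max (-y) 0) ^ n| ≤ (|a| + |b|) ^ n * |y| ^ n := by
    rw [abs_pow, ← mul_pow]
    exact pow_le_pow_left₀ (abs_nonneg _) (abs_oscillating_le a b y) n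
  have h5 := abs_sub ((a * max y 0 - b * max (-y) 0) ^ n) m
  have h6 : 0 ≤ (|a| + |b|) ^ n := by positivity
  have h7 : 0 ≤ |m| * |y| ^ n := by positivity
  linarith

lemma integrable_abs_rpow_gaussianReal {φ : ℝ → ℝ} (hφ : Continuous φ) {C : ℝ} {n : ℕ}
    (hn : 1 ≤ n) (hC : ∀ y, |φ y| ≤ C * (1 + |y| ^ n)) {q : ℝ} (hq : 1 ≤ q) :
    Integrable (fun y => |φ y| ^ q) (gaussianReal 0 1) := by
  have hn0 : (n : ENNReal) ≠ 0 := by simp; omega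
  have hpow : MemLp (fun y : ℝ => |y| ^ n) (ENNReal.ofReal q) (gaussianReal 0 1) := by
    have h := (memLp_id_gaussianReal' (μ := 0) (v := 1) (ENNReal.ofReal q * n)
      (ENNReal.mul_ne_top ENNReal.ofReal_ne_top (ENNReal.natCast_ne_top n))).norm_rpow_div
        (n : ENNReal)
    rw [ENNReal.mul_div_cancel_right hn0 (ENNReal.natCast_ne_top n)] at h
    simpa using h
  have hone : MemLp (fun _ : ℝ => (1 : ℝ)) (ENNReal.ofReal q) (gaussianReal 0 1) :=
    memLp_const 1
  have h1 : MemLp (fun y : ℝ => C * (1 + |y| ^ n)) (ENNReal.ofReal q) (gaussianReal 0 1) :=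
    (hone.add hpow).const_mul C
  have h2 : MemLp φ (ENNReal.ofReal q) (gaussianReal 0 1) :=
    h1.mono' hφ.aestronglyMeasurable (ae_of_all _ hC)
  have hq0 : ENNReal.ofReal q ≠ 0 := (ENNReal.ofReal_pos.2 (by linarith)).ne'
  have h3 := h2.integrable_norm_rpow hq0 ENNReal.ofReal_ne_top
  rwa [ENNReal.toReal_ofReal (by linarith)] at h3

lemma integral_gaussian_oscillating_pow (a b : ℝ) (n : ℕ) :
    ∫ y, (a * max y 0 - b * max (-y) 0) ^ n ∂(gaussianReal 0 1)
      = (2 : ℝ) ^ ((n : ℝ) / 2) * Real.Gamma (((n : ℝ) + 1) / 2)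
          / (2 * Real.sqrt π) * (a ^ n + (-1 : ℝ) ^ n * b ^ n) := by
  have hint : Integrable (fun y : ℝ => gaussianPDFReal 0 1 y *
      (a * max y 0 - b * max (-y) 0) ^ n) := by
    have h0 : Integrable (fun y : ℝ => (|a| + |b|) ^ n *
        (gaussianPDFReal 0 1 y * ‖y ^ n‖)) := by
      refine Integrable.const_mul ?_ _
      have := (integrable_rpow_mul_exp_neg_mul_sq (b := 1 / 2) (by norm_num)
        (s := n) (by have : (0:ℝ) ≤ n := n.cast_nonneg
                     linarith)).norm.const_mul (√(2 * π))⁻¹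
      refine this.congr (ae_of_all _ fun y => ?_)
      simp only [gaussianPDFReal, rpow_natCast, norm_mul, NNReal.coe_one, mul_one, sub_zero,
        Real.norm_eq_abs, abs_exp]
      rw [show -y ^ 2 / 2 = -(1 / 2) * y ^ 2 by ring]
      ring
    refine h0.mono' (by fun_prop) (ae_of_all _ fun y => ?_)
    rw [norm_mul, Real.norm_of_nonneg (gaussianPDFReal_nonneg _ _ _), mul_left_comm, norm_pow,
      norm_pow, ← mul_pow]
    refine mul_le_mul_of_nonneg_left (pow_le_pow_left₀ (norm_nonneg _) ?_ _)
      (gaussianPDFReal_nonneg _ _ _)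
    rw [Real.norm_eq_abs, Real.norm_eq_abs]
    exact abs_oscillating_le a b y
  have hbase : ∫ y in Ioi (0 : ℝ), gaussianPDFReal 0 1 y * y ^ n
      = (2 : ℝ) ^ ((n : ℝ) / 2) * Real.Gamma (((n : ℝ) + 1) / 2) / (2 * Real.sqrt π) := by
    have h := integral_rpow_mul_exp_neg_mul_rpow (p := 2) (q := n) (b := 1 / 2) (by norm_num)
      (by have : (0:ℝ) ≤ n := n.cast_nonneg
          linarith) (by norm_num)
    have e : ∀ y : ℝ, gaussianPDFReal 0 1 y * y ^ n
        = (√(2 * π))⁻¹ * (y ^ (n : ℝ) * rexp (-(1 / 2) * y ^ (2 : ℝ))) := fun y => by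
      simp only [gaussianPDFReal, rpow_natCast, NNReal.coe_one, mul_one, sub_zero, rpow_ofNat]
      rw [show -y ^ 2 / 2 = -(1 / 2) * y ^ 2 by ring]
      ring
    simp_rw [e]
    rw [integral_const_mul, h, one_div, Real.inv_rpow (by norm_num), ← Real.rpow_neg (by norm_num),
      neg_div, neg_neg, add_div, Real.rpow_add (by norm_num), ← Real.sqrt_eq_rpow,
      Real.sqrt_mul (by norm_num)]
    have : √(2:ℝ) ≠ 0 := by positivity
    have : √π ≠ 0 := by positivity
    field_simp
  rw [integral_gaussianReal_eq_integral_smul (by norm_num)]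
  simp only [smul_eq_mul]
  rw [← intervalIntegral.integral_Iic_add_Ioi (b := 0) hint.integrableOn hint.integrableOn]
  have hneg := integral_comp_neg_Ioi (0 : ℝ) (fun y : ℝ => gaussianPDFReal 0 1 y *
      (a * max y 0 - b * max (-y) 0) ^ n)
  rw [neg_zero] at hneg
  rw [← hneg]
  have h1 : ∫ y in Ioi (0 : ℝ), gaussianPDFReal 0 1 (-y) *
      (a * max (-y) 0 - b * max (- -y) 0) ^ n
      = ((-1) ^ n * b ^ n) * ∫ y in Ioi (0 : ℝ), gaussianPDFReal 0 1 y * y ^ n := by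
    rw [← integral_const_mul]
    refine setIntegral_congr_fun measurableSet_Ioi fun y hy => ?_
    have hy : 0 < y := hy
    have : gaussianPDFReal 0 1 (-y) = gaussianPDFReal 0 1 y := by simp [gaussianPDFReal]
    simp only [this, neg_neg, max_eq_left hy.le, max_eq_right (neg_nonpos.2 hy.le)]
    rw [← mul_pow, mul_left_comm, ← mul_pow]
    ring
  have h2 : ∫ y in Ioi (0 : ℝ), gaussianPDFReal 0 1 y *
      (a * max y 0 - b * max (-y) 0) ^ n
      = a ^ n * ∫ y in Ioi (0 : ℝ), gaussianPDFReal 0 1 y * y ^ n := by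
    rw [← integral_const_mul]
    refine setIntegral_congr_fun measurableSet_Ioi fun y hy => ?_
    have hy : 0 < y := hy
    simp only [max_eq_left hy.le, max_eq_right (neg_nonpos.2 hy.le)]
    ring
  rw [h1, h2, hbase]
  ring

lemma integrable_pow_norm_of_isGaussian {E : Type*} [NormedAddCommGroup E] [NormedSpace ℝ E]
    [MeasurableSpace E] [BorelSpace E] [SecondCountableTopology E] [CompleteSpace E]
    (μ : Measure E) [IsGaussian μ] (k : ℕ) : Integrable (fun x => ‖x‖ ^ k) μ := by
  simpa using (IsGaussian.memLp_id μ k (by simp)).integrable_norm_pow'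

lemma tendsto_integral_mul_correlated_gaussian {φ : ℝ → ℝ} (hφ : Continuous φ) {C : ℝ} {n : ℕ}
    (hC : ∀ y, |φ y| ≤ C * (1 + |y| ^ n)) (h0 : ∫ y, φ y ∂(gaussianReal 0 1) = 0) :
    Tendsto (fun ρ : ℝ => ∫ z : ℝ × ℝ, φ z.1 * φ (ρ * z.1 + √(1 - ρ ^ 2) * z.2)
      ∂((gaussianReal 0 1).prod (gaussianReal 0 1))) (nhds 0) (nhds 0) := by
  have hC0 : 0 ≤ C := by
    have h1 := (abs_nonneg _).trans (hC 0)
    have h2 : (0 : ℝ) < 1 + |(0 : ℝ)| ^ n := by positivity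
    exact nonneg_of_mul_nonneg_left h1 h2
  have hzero : ∫ z : ℝ × ℝ, φ z.1 * φ (0 * z.1 + √(1 - 0 ^ 2) * z.2)
      ∂((gaussianReal 0 1).prod (gaussianReal 0 1)) = 0 := by
    simp only [zero_mul, zero_add, ne_eq, OfNat.ofNat_ne_zero, not_false_eq_true, zero_pow,
      sub_zero, Real.sqrt_one, one_mul]
    rw [integral_prod_mul, h0, zero_mul]
  have hcont : ContinuousAt (fun ρ : ℝ => ∫ z : ℝ × ℝ, φ z.1 * φ (ρ * z.1 + √(1 - ρ ^ 2) * z.2)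
      ∂((gaussianReal 0 1).prod (gaussianReal 0 1))) 0 := by
    have hpow := integrable_pow_norm_of_isGaussian ((gaussianReal 0 1).prod (gaussianReal 0 1))
    refine continuousAt_of_dominated (F := fun (ρ : ℝ) (z : ℝ × ℝ) =>
        φ z.1 * φ (ρ * z.1 + √(1 - ρ ^ 2) * z.2))
      (bound := fun z => C * C * (1 + (1 + 2 ^ n) * ‖z‖ ^ n + 2 ^ n * ‖z‖ ^ (n + n)))
      (Eventually.of_forall fun ρ => by fun_prop) ?_ ?_
      (ae_of_all _ fun z => by fun_prop)
    · filter_upwards [Icc_mem_nhds (show (-1 : ℝ) < 0 by norm_num) (show (0 : ℝ) < 1 by norm_num)]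
        with ρ hρ
      refine ae_of_all _ fun z => ?_
      have hz1 : |z.1| ≤ ‖z‖ := norm_fst_le z
      have hz2 : |z.2| ≤ ‖z‖ := norm_snd_le z
      have hρ1 : |ρ| ≤ 1 := abs_le.2 hρ
      have hs : |√(1 - ρ ^ 2)| ≤ 1 := by
        rw [abs_of_nonneg (Real.sqrt_nonneg _)]
        exact Real.sqrt_le_one.2 (by nlinarith [sq_nonneg ρ])
      have hlin : |ρ * z.1 + √(1 - ρ ^ 2) * z.2| ≤ 2 * ‖z‖ := by
        refine (abs_add_le _ _).trans ?_
        rw [abs_mul, abs_mul, two_mul]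
        exact add_le_add ((mul_le_of_le_one_left (abs_nonneg _) hρ1).trans hz1)
          ((mul_le_of_le_one_left (abs_nonneg _) hs).trans hz2)
      rw [norm_mul]
      calc ‖φ z.1‖ * ‖φ (ρ * z.1 + √(1 - ρ ^ 2) * z.2)‖
          ≤ (C * (1 + ‖z‖ ^ n)) * (C * (1 + (2 * ‖z‖) ^ n)) := by
            refine mul_le_mul ((hC _).trans ?_) ((hC _).trans ?_) (norm_nonneg _) (by positivity)
            all_goals gcongr
        _ = _ := by rw [mul_pow, pow_add]; ring
    · exact (((integrable_const 1).add ((hpow n).const_mul _)).add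
        ((hpow (n + n)).const_mul _)).const_mul _
  have := hcont.tendsto
  rwa [hzero] at this

lemma map_pair_eq_correlated_gaussian {Ω : Type*} [MeasurableSpace Ω] {P : Measure Ω}
    [IsProbabilityMeasure P] {U V : Ω → ℝ} (hU : Measurable U) (hV : Measurable V) {ρ : ℝ}
    (hρ : |ρ| ≤ 1)
    (h : ∀ c d : ℝ, P.map (fun ω => c * U ω + d * V ω)
      = gaussianReal 0 (Real.toNNReal (c ^ 2 + d ^ 2 + 2 * c * d * ρ))) :
    P.map (fun ω => (U ω, V ω)) = ((gaussianReal 0 1).prod (gaussianReal 0 1)).map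
      (fun z : ℝ × ℝ => (z.1, ρ * z.1 + √(1 - ρ ^ 2) * z.2)) := by
  have hm1 : Measurable (fun ω => (U ω, V ω)) := by fun_prop
  have hm2 : Measurable (fun z : ℝ × ℝ => (z.1, ρ * z.1 + √(1 - ρ ^ 2) * z.2)) := by fun_prop
  have := Measure.isProbabilityMeasure_map (μ := P) hm1.aemeasurable
  have := Measure.isProbabilityMeasure_map
    (μ := (gaussianReal 0 1).prod (gaussianReal 0 1)) hm2.aemeasurable
  refine Measure.ext_of_charFunDual ?_
  ext L
  rw [charFunDual_eq_charFun_map_one, charFunDual_eq_charFun_map_one,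
    Measure.map_map (by fun_prop) hm1, Measure.map_map (by fun_prop) hm2]
  have hL : ∀ x y : ℝ, L (x, y) = L (1, 0) * x + L (0, 1) * y := fun x y => by
    have : ((x, y) : ℝ × ℝ) = x • (1, 0) + y • (0, 1) := by simp
    rw [this, map_add, map_smul, map_smul, smul_eq_mul, smul_eq_mul]
    ring
  generalize L (1, 0) = c at hL
  generalize L (0, 1) = d at hL
  have e1 : (⇑L ∘ fun ω => (U ω, V ω)) = fun ω => c * U ω + d * V ω := by
    ext ω; simp [hL]
  have e2 : (⇑L ∘ fun z : ℝ × ℝ => (z.1, ρ * z.1 + √(1 - ρ ^ 2) * z.2))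
      = (fun z : ℝ × ℝ => (c + d * ρ) * z.1) + fun z => (d * √(1 - ρ ^ 2)) * z.2 := by
    ext z; simp only [Function.comp, hL, Pi.add_apply]; ring
  have hind : IndepFun (fun z : ℝ × ℝ => (c + d * ρ) * z.1)
      (fun z : ℝ × ℝ => (d * √(1 - ρ ^ 2)) * z.2)
      ((gaussianReal 0 1).prod (gaussianReal 0 1)) :=
    indepFun_prod (X := fun x : ℝ => (c + d * ρ) * x) (Y := fun x : ℝ => (d * √(1 - ρ ^ 2)) * x)
      (by fun_prop) (by fun_prop)
  have hfst : ((gaussianReal 0 1).prod (gaussianReal 0 1)).map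
      (fun z : ℝ × ℝ => (c + d * ρ) * z.1)
      = gaussianReal ((c + d * ρ) * 0) (.mk ((c + d * ρ) ^ 2) (sq_nonneg _) * 1) := by
    have := Measure.map_map (μ := (gaussianReal 0 1).prod (gaussianReal 0 1))
      (g := fun x : ℝ => (c + d * ρ) * x) (f := Prod.fst) (by fun_prop) (by fun_prop)
    rw [Function.comp_def] at this
    rw [← this, measurePreserving_fst.map_eq, gaussianReal_map_const_mul]
  have hsnd : ((gaussianReal 0 1).prod (gaussianReal 0 1)).map
      (fun z : ℝ × ℝ => (d * √(1 - ρ ^ 2)) * z.2)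
      = gaussianReal ((d * √(1 - ρ ^ 2)) * 0) (.mk ((d * √(1 - ρ ^ 2)) ^ 2) (sq_nonneg _) * 1) := by
    have := Measure.map_map (μ := (gaussianReal 0 1).prod (gaussianReal 0 1))
      (g := fun x : ℝ => (d * √(1 - ρ ^ 2)) * x) (f := Prod.snd) (by fun_prop) (by fun_prop)
    rw [Function.comp_def] at this
    rw [← this, measurePreserving_snd.map_eq, gaussianReal_map_const_mul]
  rw [e1, e2, h, gaussianReal_add_gaussianReal_of_indepFun hind hfst hsnd]
  congr 2
  · simp
  · have h1 : 0 ≤ 1 - ρ ^ 2 := by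
      have := sq_abs ρ
      nlinarith [abs_nonneg ρ]
    have h2 := Real.sq_sqrt h1
    have h3 : c ^ 2 + d ^ 2 + 2 * c * d * ρ = (c + d * ρ) ^ 2 + d ^ 2 * (1 - ρ ^ 2) := by ring
    ext
    rw [Real.coe_toNNReal _ (by rw [h3]; positivity)]
    simp only [mul_one, NNReal.coe_add, NNReal.coe_mk, mul_pow, h2]
    linarith

lemma abs_integral_rpow_le_integral {α : Type*} [MeasurableSpace α] {ν : Measure α}
    [IsProbabilityMeasure ν] {g : α → ℝ} {q : ℝ} (hq : 1 ≤ q) (hg : Integrable g ν)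
    (hgq : Integrable (fun u => |g u| ^ q) ν) : |∫ u, g u ∂ν| ^ q ≤ ∫ u, |g u| ^ q ∂ν :=
  (Real.rpow_le_rpow (abs_nonneg _) abs_integral_le_integral_abs (by linarith)).trans
    ((convexOn_rpow hq).map_integral_le
      (continuousOn_id.rpow_const fun _ _ => Or.inr (by linarith)) isClosed_Ici
      (ae_of_all _ fun _ => mem_Ici.2 (abs_nonneg _)) hg.abs hgq)

lemma measurePreserving_of_map_eq {α Ω : Type*} [MeasurableSpace α] [MeasurableSpace Ω]
    {ν : Measure α} [IsProbabilityMeasure ν] {P : Measure Ω} [IsProbabilityMeasure P]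
    {γ : Measure ℝ} {Y : α → Ω → ℝ} (hY : Measurable (Function.uncurry Y))
    (hlaw : ∀ᵐ u ∂ν, P.map (Y u) = γ) :
    MeasurePreserving (fun z : Ω × α => Y z.2 z.1) (P.prod ν) γ := by
  have hm : Measurable (fun z : Ω × α => Y z.2 z.1) := hY.comp measurable_swap
  refine ⟨hm, ?_⟩
  ext S hS
  rw [Measure.map_apply hm hS, Measure.prod_apply_symm (hm hS)]
  calc ∫⁻ u, P ((fun ω => (ω, u)) ⁻¹' ((fun z : Ω × α => Y z.2 z.1) ⁻¹' S)) ∂ν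
      = ∫⁻ _, γ S ∂ν := by
        refine lintegral_congr_ae ?_
        filter_upwards [hlaw] with u hu
        have hYu : Measurable (Y u) := hY.comp measurable_prodMk_left
        rw [← hu, Measure.map_apply hYu hS]
        rfl
    _ = γ S := by simp

lemma integral_abs_integral_rpow_le {α Ω : Type*} [MeasurableSpace α] [MeasurableSpace Ω]
    {ν : Measure α} [IsProbabilityMeasure ν] {P : Measure Ω} [IsProbabilityMeasure P]
    {G : Ω × α → ℝ} {q : ℝ} (hq : 1 ≤ q) (hG : Integrable G (P.prod ν))
    (hGq : Integrable (fun z => |G z| ^ q) (P.prod ν)) :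
    Integrable (fun ω => |∫ u, G (ω, u) ∂ν| ^ q) P ∧
      ∫ ω, |∫ u, G (ω, u) ∂ν| ^ q ∂P ≤ ∫ z, |G z| ^ q ∂(P.prod ν) := by
  have hle : ∀ᵐ ω ∂P, |∫ u, G (ω, u) ∂ν| ^ q ≤ ∫ u, |G (ω, u)| ^ q ∂ν := by
    filter_upwards [hG.prod_right_ae, hGq.prod_right_ae] with ω h1 h2
    exact abs_integral_rpow_le_integral hq h1 h2
  have hint : Integrable (fun ω => |∫ u, G (ω, u) ∂ν| ^ q) P := by
    refine hGq.integral_prod_left.mono' ?_ ?_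
    · have := hG.integral_prod_left.aestronglyMeasurable.aemeasurable
      exact (this.abs.pow_const q).aestronglyMeasurable
    · filter_upwards [hle] with ω h
      rwa [Real.norm_of_nonneg (by positivity)]
  refine ⟨hint, ?_⟩
  rw [integral_prod _ hGq]
  exact integral_mono_ae hint hGq.integral_prod_left hle

lemma integral_sq_integral_eq {α Ω : Type*} [MeasurableSpace α] [MeasurableSpace Ω]
    {ν : Measure α} [IsProbabilityMeasure ν] {P : Measure Ω} [IsProbabilityMeasure P]
    {G : Ω × α → ℝ} (hGm : Measurable G) (hG2 : Integrable (fun z => G z ^ 2) (P.prod ν)) :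
    Integrable (fun w : α × α => ∫ ω, G (ω, w.1) * G (ω, w.2) ∂P) (ν.prod ν) ∧
    ∫ ω, (∫ u, G (ω, u) ∂ν) ^ 2 ∂P
      = ∫ w : α × α, ∫ ω, G (ω, w.1) * G (ω, w.2) ∂P ∂(ν.prod ν) := by
  have hfst : MeasurePreserving (Prod.map id Prod.fst : Ω × (α × α) → Ω × α)
      (P.prod (ν.prod ν)) (P.prod ν) := (MeasurePreserving.id P).prod measurePreserving_fst
  have hsnd : MeasurePreserving (Prod.map id Prod.snd : Ω × (α × α) → Ω × α)
      (P.prod (ν.prod ν)) (P.prod ν) := (MeasurePreserving.id P).prod measurePreserving_snd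
  have hint : Integrable (fun z : Ω × (α × α) => G (z.1, z.2.1) * G (z.1, z.2.2))
      (P.prod (ν.prod ν)) := by
    refine ((hfst.integrable_comp_of_integrable hG2).add
      (hsnd.integrable_comp_of_integrable hG2)).mono' (by fun_prop) (ae_of_all _ fun z => ?_)
    simp only [Pi.add_apply, Function.comp, Prod.map, id]
    rw [Real.norm_eq_abs, abs_le]
    constructor <;>
      nlinarith [sq_nonneg (G (z.1, z.2.1) + G (z.1, z.2.2)),
        sq_nonneg (G (z.1, z.2.1) - G (z.1, z.2.2)),
        sq_nonneg (G (z.1, z.2.1)), sq_nonneg (G (z.1, z.2.2))]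
  refine ⟨hint.integral_prod_right, ?_⟩
  rw [← integral_integral_swap (f := fun ω (w : α × α) => G (ω, w.1) * G (ω, w.2)) hint]
  refine integral_congr_ae (ae_of_all _ fun ω => ?_)
  simp only
  rw [integral_prod_mul (fun u => G (ω, u)) (fun u => G (ω, u)), sq]

lemma measureReal_prod_near_diagonal_le {L T : ℝ} (hL : 0 ≤ L) (hT : 0 < T) :
    (((ENNReal.ofReal T)⁻¹ • (volume : Measure ℝ).restrict (Ioc 0 T)).prod
      ((ENNReal.ofReal T)⁻¹ • (volume : Measure ℝ).restrict (Ioc 0 T))).real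
        {w | |w.2 - w.1| < L} ≤ 2 * L / T := by
  set ν := (ENNReal.ofReal T)⁻¹ • (volume : Measure ℝ).restrict (Ioc 0 T) with hν
  have hνp : IsProbabilityMeasure ν := ⟨by
    simp [hν, ENNReal.inv_mul_cancel, hT]⟩
  have hS : MeasurableSet {w : ℝ × ℝ | |w.2 - w.1| < L} :=
    measurableSet_lt (by fun_prop) (by fun_prop)
  refine ENNReal.toReal_le_of_le_ofReal (by positivity) ?_
  rw [Measure.prod_apply hS]
  calc ∫⁻ u, ν (Prod.mk u ⁻¹' {w : ℝ × ℝ | |w.2 - w.1| < L}) ∂ν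
      ≤ ∫⁻ _, ENNReal.ofReal (2 * L / T) ∂ν := by
        refine lintegral_mono fun u => ?_
        have : Prod.mk u ⁻¹' {w : ℝ × ℝ | |w.2 - w.1| < L} = Ioo (u - L) (u + L) := by
          ext v
          simp only [mem_preimage, mem_ofPred_eq, mem_Ioo, abs_lt]
          constructor <;> rintro ⟨h1, h2⟩ <;> constructor <;> linarith
        rw [this, hν, Measure.smul_apply, smul_eq_mul, ENNReal.ofReal_div_of_pos hT,
          ENNReal.div_eq_inv_mul]
        gcongr
        refine (Measure.restrict_apply_le _ _).trans ?_
        rw [Real.volume_Ioo]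
        exact ENNReal.ofReal_le_ofReal (by linarith)
    _ = ENNReal.ofReal (2 * L / T) := by simp

lemma exists_abs_covariance_le {Ω : Type*} [MeasurableSpace Ω] {P : Measure Ω}
    [IsProbabilityMeasure P] {Y : ℝ → Ω → ℝ} (hYmeas : Measurable (Function.uncurry Y))
    {r : ℝ → ℝ} (hreven : ∀ t, r (-t) = r t)
    (hGauss : ∀ s t : ℝ, 0 ≤ s → 0 ≤ t → ∀ c d : ℝ,
      P.map (fun ω => c * Y s ω + d * Y t ω)
        = gaussianReal 0 (Real.toNNReal (c ^ 2 + d ^ 2 + 2 * c * d * r (t - s))))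
    (hrlim : Tendsto r atTop (nhds 0)) {φ : ℝ → ℝ} (hφ : Continuous φ) {C : ℝ} {n : ℕ}
    (hC : ∀ y, |φ y| ≤ C * (1 + |y| ^ n)) (h0 : ∫ y, φ y ∂(gaussianReal 0 1) = 0)
    {ε : ℝ} (hε : 0 < ε) :
    ∃ L : ℝ, 0 < L ∧ ∀ s t : ℝ, 0 ≤ s → 0 ≤ t → L ≤ |t - s| →
      |∫ ω, φ (Y s ω) * φ (Y t ω) ∂P| ≤ ε := by
  have hY : ∀ u, Measurable (Y u) := fun u => hYmeas.comp measurable_prodMk_left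
  have hev : ∀ᶠ ρ : ℝ in nhds 0, |ρ| ≤ 1 ∧
      |∫ z : ℝ × ℝ, φ z.1 * φ (ρ * z.1 + √(1 - ρ ^ 2) * z.2)
        ∂((gaussianReal 0 1).prod (gaussianReal 0 1))| ≤ ε := by
    have h1 := (tendsto_integral_mul_correlated_gaussian hφ hC h0).abs
    rw [abs_zero] at h1
    have h2 : Tendsto (fun ρ : ℝ => |ρ|) (nhds 0) (nhds 0) := by
      simpa using (continuous_abs.tendsto (0 : ℝ))
    exact (h2.eventually_le_const one_pos).and (h1.eventually_le_const hε)
  obtain ⟨L, hL⟩ := eventually_atTop.1 (hrlim.eventually hev)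
  refine ⟨max L 1, by positivity, fun s t hs ht hst => ?_⟩
  have hr : r |t - s| = r (t - s) := by
    rcases abs_choice (t - s) with h | h <;> rw [h]
    exact hreven _
  obtain ⟨hρ, hI⟩ := hL _ ((le_max_left _ _).trans hst)
  rw [hr] at hρ hI
  have hlaw := map_pair_eq_correlated_gaussian (hY s) (hY t) hρ (hGauss s t hs ht)
  have hψ : Continuous (fun x : ℝ × ℝ => φ x.1 * φ x.2) := by fun_prop
  have e1 := integral_map (μ := P) (φ := fun ω => (Y s ω, Y t ω))
    ((hY s).prodMk (hY t)).aemeasurable (f := fun x : ℝ × ℝ => φ x.1 * φ x.2)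
    hψ.aestronglyMeasurable
  have e2 := integral_map (μ := (gaussianReal 0 1).prod (gaussianReal 0 1))
    (φ := fun z : ℝ × ℝ => (z.1, r (t - s) * z.1 + √(1 - r (t - s) ^ 2) * z.2))
    (by fun_prop) (f := fun x : ℝ × ℝ => φ x.1 * φ x.2) hψ.aestronglyMeasurable
  rw [← e1, hlaw, e2]
  exact hI

lemma isProbabilityMeasure_uniform_Ioc {T : ℝ} (hT : 0 < T) :
    IsProbabilityMeasure ((ENNReal.ofReal T)⁻¹ • (volume : Measure ℝ).restrict (Ioc 0 T)) :=
  ⟨by simp [ENNReal.inv_mul_cancel, hT]⟩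

lemma ae_uniform_Ioc_nonneg (T : ℝ) :
    ∀ᵐ u ∂((ENNReal.ofReal T)⁻¹ • (volume : Measure ℝ).restrict (Ioc 0 T)), 0 ≤ u :=
  Measure.ae_smul_measure ((ae_restrict_mem measurableSet_Ioc).mono fun _ hu => hu.1.le) _

lemma tendsto_integral_sq_timeAverage {Ω : Type*} [MeasurableSpace Ω] {P : Measure Ω}
    [IsProbabilityMeasure P] {Y : ℝ → Ω → ℝ} (hYmeas : Measurable (Function.uncurry Y))
    (hlaw : ∀ u, 0 ≤ u → P.map (Y u) = gaussianReal 0 1) {φ : ℝ → ℝ} (hφ : Continuous φ)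
    (hφ2 : Integrable (fun y => φ y ^ 2) (gaussianReal 0 1))
    (hcov : ∀ ε : ℝ, 0 < ε → ∃ L : ℝ, 0 < L ∧ ∀ s t : ℝ, 0 ≤ s → 0 ≤ t → L ≤ |t - s| →
      |∫ ω, φ (Y s ω) * φ (Y t ω) ∂P| ≤ ε) :
    Tendsto (fun T : ℝ => ∫ ω, (∫ u, φ (Y u ω)
      ∂((ENNReal.ofReal T)⁻¹ • (volume : Measure ℝ).restrict (Ioc 0 T))) ^ 2 ∂P)
      atTop (nhds 0) := by
  have hY : ∀ u, Measurable (Y u) := fun u => hYmeas.comp measurable_prodMk_left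
  have hm : Measurable (fun z : Ω × ℝ => Y z.2 z.1) := hYmeas.comp measurable_swap
  set K := ∫ y, φ y ^ 2 ∂(gaussianReal 0 1) with hK
  have hK0 : 0 ≤ K := integral_nonneg fun _ => sq_nonneg _
  have hsq : ∀ u, 0 ≤ u → Integrable (fun ω => φ (Y u ω) ^ 2) P ∧
      ∫ ω, φ (Y u ω) ^ 2 ∂P = K := fun u hu => by
    have hmp : MeasurePreserving (Y u) P (gaussianReal 0 1) := ⟨hY u, hlaw u hu⟩
    refine ⟨hmp.integrable_comp_of_integrable hφ2, ?_⟩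
    rw [hK, ← hlaw u hu, integral_map (hY u).aemeasurable (by fun_prop)]
  have hcovK : ∀ s t, 0 ≤ s → 0 ≤ t → |∫ ω, φ (Y s ω) * φ (Y t ω) ∂P| ≤ 2 * K :=
    fun s t hs ht => by
    have hi := (hsq s hs).1.add (hsq t ht).1
    refine (norm_integral_le_of_norm_le (f := fun ω => φ (Y s ω) * φ (Y t ω)) hi
      (ae_of_all _ fun ω => ?_)).trans ?_
    · rw [Real.norm_eq_abs, abs_le]
      simp only [Pi.add_apply]
      constructor <;>
        nlinarith [sq_nonneg (φ (Y s ω) + φ (Y t ω)), sq_nonneg (φ (Y s ω) - φ (Y t ω)),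
          sq_nonneg (φ (Y s ω)), sq_nonneg (φ (Y t ω))]
    · simp only [Pi.add_apply]
      rw [integral_add (hsq s hs).1 (hsq t ht).1, (hsq s hs).2, (hsq t ht).2, two_mul]
  have hbound : ∀ ε : ℝ, 0 < ε → ∃ L : ℝ, 0 < L ∧ ∀ T : ℝ, 0 < T → ∫ ω, (∫ u, φ (Y u ω)
      ∂((ENNReal.ofReal T)⁻¹ • (volume : Measure ℝ).restrict (Ioc 0 T))) ^ 2 ∂P
        ≤ ε + 2 * K * (2 * L / T) := by
    intro ε hε
    obtain ⟨L, hL, hLε⟩ := hcov ε hε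
    refine ⟨L, hL, fun T hT => ?_⟩
    have hdiag := measureReal_prod_near_diagonal_le hL.le hT
    have := isProbabilityMeasure_uniform_Ioc hT
    have hpos := ae_uniform_Ioc_nonneg T
    set ν := (ENNReal.ofReal T)⁻¹ • (volume : Measure ℝ).restrict (Ioc 0 T)
    have hmp := measurePreserving_of_map_eq (P := P) hYmeas (hpos.mono hlaw)
    obtain ⟨hki, hk⟩ := integral_sq_integral_eq (ν := ν) (P := P)
      (G := fun z => φ (Y z.2 z.1)) (hφ.measurable.comp hm)
      (hmp.integrable_comp_of_integrable hφ2)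
    have hS : MeasurableSet {w : ℝ × ℝ | |w.2 - w.1| < L} :=
      measurableSet_lt (by fun_prop) (by fun_prop)
    rw [hk]
    calc ∫ w : ℝ × ℝ, ∫ ω, φ (Y w.1 ω) * φ (Y w.2 ω) ∂P ∂(ν.prod ν)
        ≤ ∫ w, (ε + {w : ℝ × ℝ | |w.2 - w.1| < L}.indicator (fun _ => 2 * K) w)
            ∂(ν.prod ν) := by
          refine integral_mono_ae hki
            ((integrable_const _).add ((integrable_const _).indicator hS)) ?_
          filter_upwards [measurePreserving_fst.quasiMeasurePreserving.ae hpos,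
            measurePreserving_snd.quasiMeasurePreserving.ae hpos] with w h1 h2
          by_cases hw : w ∈ {w : ℝ × ℝ | |w.2 - w.1| < L}
          · rw [indicator_of_mem hw]
            linarith [(le_abs_self _).trans (hcovK _ _ h1 h2)]
          · rw [indicator_of_notMem hw, add_zero]
            exact (le_abs_self _).trans (hLε _ _ h1 h2 (not_lt.1 hw))
      _ = ε + 2 * K * (ν.prod ν).real {w | |w.2 - w.1| < L} := by
          rw [integral_add (integrable_const _) ((integrable_const _).indicator hS),
            integral_indicator_const _ hS]
          simp [mul_comm]
      _ ≤ _ := by gcongr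
  refine tendsto_order.2 ⟨fun a ha => Eventually.of_forall fun T =>
    ha.trans_le (integral_nonneg fun _ => sq_nonneg _), fun a ha => ?_⟩
  obtain ⟨L, hL, hLT⟩ := hbound (a / 2) (half_pos ha)
  have hlim : Tendsto (fun T : ℝ => a / 2 + 2 * K * (2 * L / T)) atTop (nhds (a / 2)) := by
    simpa using ((tendsto_const_nhds.div_atTop tendsto_id).const_mul (2 * K)).const_add (a / 2)
  filter_upwards [hlim.eventually_lt_const (half_lt_self ha), eventually_gt_atTop 0]
    with T h1 h2
  exact (hLT T h2).trans_lt h1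

lemma rpow_le_sq_add_rpow {x p ε : ℝ} (hx : 0 ≤ x) (hp : 1 ≤ p) (hε : 0 < ε) :
    x ^ p ≤ ε⁻¹ * x ^ 2 + ε * (1 + x ^ (2 * p)) := by
  have h1 : x ^ p = x * x ^ (p - 1) := by
    rw [← Real.rpow_one_add' hx (by linarith)]
    congr 1; ring
  have h2 : (x ^ (p - 1)) ^ 2 ≤ 1 + x ^ (2 * p) := by
    rw [← Real.rpow_natCast, ← Real.rpow_mul hx]
    push_cast
    rcases le_total x 1 with h | h
    · have := Real.rpow_le_one hx h (z := (p - 1) * 2) (by linarith)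
      have := Real.rpow_nonneg hx (2 * p)
      linarith
    · have := Real.rpow_le_rpow_of_exponent_le h (show (p - 1) * 2 ≤ 2 * p by linarith)
      linarith
  have h3 : x * x ^ (p - 1) ≤ ε⁻¹ * x ^ 2 + ε * (x ^ (p - 1)) ^ 2 := by
    have e : ε⁻¹ * x ^ 2 + ε * (x ^ (p - 1)) ^ 2 - x * x ^ (p - 1)
        = ε⁻¹ * ((x - ε * x ^ (p - 1) / 2) ^ 2 + 3 / 4 * (ε * x ^ (p - 1)) ^ 2) := by
      field_simp
      ring
    have : 0 ≤ ε⁻¹ * ((x - ε * x ^ (p - 1) / 2) ^ 2 + 3 / 4 * (ε * x ^ (p - 1)) ^ 2) := by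
      positivity
    linarith
  rw [h1]
  exact h3.trans (by gcongr)

lemma tendsto_integral_abs_timeAverage_rpow {Ω : Type*} [MeasurableSpace Ω] {P : Measure Ω}
    [IsProbabilityMeasure P] {Y : ℝ → Ω → ℝ} (hYmeas : Measurable (Function.uncurry Y))
    (hlaw : ∀ u, 0 ≤ u → P.map (Y u) = gaussianReal 0 1) {φ : ℝ → ℝ} (hφ : Continuous φ)
    (hφq : ∀ q : ℝ, 1 ≤ q → Integrable (fun y => |φ y| ^ q) (gaussianReal 0 1))
    (hcov : ∀ ε : ℝ, 0 < ε → ∃ L : ℝ, 0 < L ∧ ∀ s t : ℝ, 0 ≤ s → 0 ≤ t → L ≤ |t - s| →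
      |∫ ω, φ (Y s ω) * φ (Y t ω) ∂P| ≤ ε) {p : ℝ} (hp : 1 ≤ p) :
    Tendsto (fun T : ℝ => ∫ ω, |∫ u, φ (Y u ω)
      ∂((ENNReal.ofReal T)⁻¹ • (volume : Measure ℝ).restrict (Ioc 0 T))| ^ p ∂P)
      atTop (nhds 0) := by
  have hφ1 : Integrable φ (gaussianReal 0 1) := by
    have := hφq 1 le_rfl
    simp only [Real.rpow_one] at this
    exact (integrable_norm_iff hφ.aestronglyMeasurable).1 this
  have hφ2 : Integrable (fun y => φ y ^ 2) (gaussianReal 0 1) := by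
    simpa using hφq 2 (by norm_num)
  have hsq := tendsto_integral_sq_timeAverage hYmeas hlaw hφ hφ2 hcov
  set A : ℝ → Ω → ℝ := fun T ω => ∫ u, φ (Y u ω)
      ∂((ENNReal.ofReal T)⁻¹ • (volume : Measure ℝ).restrict (Ioc 0 T))
  set M := ∫ y, |φ y| ^ (2 * p) ∂(gaussianReal 0 1)
  have hM0 : 0 ≤ M := integral_nonneg fun _ => by positivity
  have hmom : ∀ T, 0 < T → ∀ q : ℝ, 1 ≤ q → Integrable (fun ω => |A T ω| ^ q) P ∧
      ∫ ω, |A T ω| ^ q ∂P ≤ ∫ y, |φ y| ^ q ∂(gaussianReal 0 1) := fun T hT q hq => by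
    have := isProbabilityMeasure_uniform_Ioc hT
    have hmp := measurePreserving_of_map_eq (P := P) hYmeas
      ((ae_uniform_Ioc_nonneg T).mono hlaw)
    have h := integral_abs_integral_rpow_le (G := fun z : Ω × ℝ => φ (Y z.2 z.1)) hq
      (hmp.integrable_comp_of_integrable hφ1) (hmp.integrable_comp_of_integrable (hφq q hq))
    refine ⟨h.1, h.2.trans_eq ?_⟩
    rw [← hmp.map_eq, integral_map hmp.aemeasurable]
    rw [hmp.map_eq]
    exact (hφq q hq).aestronglyMeasurable
  have hbound : ∀ ε : ℝ, 0 < ε → ∀ T, 0 < T →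
      ∫ ω, |A T ω| ^ p ∂P ≤ ε⁻¹ * ∫ ω, A T ω ^ 2 ∂P + ε * (1 + M) := by
    intro ε hε T hT
    have i2 : Integrable (fun ω => A T ω ^ 2) P := by
      simpa using (hmom T hT 2 (by norm_num)).1
    obtain ⟨iq, hq⟩ := hmom T hT (2 * p) (by linarith)
    have j1 := i2.const_mul ε⁻¹
    have j2 : Integrable (fun ω => ε * (1 + |A T ω| ^ (2 * p))) P :=
      ((integrable_const (1 : ℝ)).add iq).const_mul ε
    calc ∫ ω, |A T ω| ^ p ∂P
        ≤ ∫ ω, (ε⁻¹ * A T ω ^ 2 + ε * (1 + |A T ω| ^ (2 * p))) ∂P := by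
          refine integral_mono (hmom T hT p hp).1 (j1.add j2) fun ω => ?_
          have := rpow_le_sq_add_rpow (abs_nonneg (A T ω)) hp hε
          rwa [sq_abs] at this
      _ = ε⁻¹ * ∫ ω, A T ω ^ 2 ∂P + ε * (1 + ∫ ω, |A T ω| ^ (2 * p) ∂P) := by
          rw [integral_add j1 j2, integral_const_mul, integral_const_mul,
            integral_add (integrable_const _) iq]
          simp
      _ ≤ _ := by gcongr
  refine tendsto_order.2 ⟨fun a ha => Eventually.of_forall fun T =>
    ha.trans_le (integral_nonneg fun _ => by positivity), fun a ha => ?_⟩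
  have hε : 0 < a / 2 / (1 + M) := by positivity
  have hlim := (hsq.const_mul (a / 2 / (1 + M))⁻¹).add_const (a / 2 / (1 + M) * (1 + M))
  rw [mul_zero, zero_add, div_mul_cancel₀ _ (by positivity)] at hlim
  filter_upwards [hlim.eventually_lt_const (half_lt_self ha), eventually_gt_atTop 0]
    with T h1 h2
  refine (hbound _ hε T h2).trans_lt ?_
  rwa [div_mul_cancel₀ _ (by positivity)]

/-- Proposition 3.5 (law of large numbers in `L^p`): for a stationary Gaussian process `Y`
with unit variance, covariance function `r` vanishing at infinity, and the oscillating
process `X_t = α₊ Y_t 1_{Y_t>0} + α₋ Y_t 1_{Y_t<0}`, the time averages of `X_uⁿ` converge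
in `L^p` to `μ_n = 2^{n/2} Γ((n+1)/2) / (2√π) · (α₊ⁿ + (-1)ⁿ α₋ⁿ)`. -/
theorem oscillating_gaussian_lln
    {Ω : Type*} [MeasurableSpace Ω] (P : Measure Ω) [IsProbabilityMeasure P]
    (Y : ℝ → Ω → ℝ) (hYmeas : Measurable (Function.uncurry Y))
    (r : ℝ → ℝ) (hreven : ∀ t, r (-t) = r t) (hr0 : r 0 = 1)
    (hGauss : ∀ s t : ℝ, 0 ≤ s → 0 ≤ t → ∀ c d : ℝ,
      P.map (fun ω => c * Y s ω + d * Y t ω)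
        = gaussianReal 0 (Real.toNNReal (c ^ 2 + d ^ 2 + 2 * c * d * r (t - s))))
    (hrlim : Tendsto r atTop (nhds 0))
    (αp αm : ℝ) (hαp : 0 < αp) (hαm : 0 < αm)
    (X : ℝ → Ω → ℝ)
    (hX : ∀ t ω, X t ω = αp * Y t ω * (if 0 < Y t ω then (1 : ℝ) else 0)
            + αm * Y t ω * (if Y t ω < 0 then (1 : ℝ) else 0))
    (n : ℕ) (hn : 1 ≤ n) (p : ℝ) (hp : 1 ≤ p)
    (μn : ℝ)
    (hμn : μn = (2 : ℝ) ^ ((n : ℝ) / 2) * Real.Gamma (((n : ℝ) + 1) / 2)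
              / (2 * Real.sqrt π) * (αp ^ n + (-1 : ℝ) ^ n * αm ^ n)) :
    Tendsto (fun T : ℝ =>
        ∫ ω, |(1 / T) * (∫ u in Set.Ioc (0 : ℝ) T, (X u ω) ^ n) - μn| ^ p ∂P)
      atTop (nhds 0) := by
  have hφX : ∀ u ω, X u ω = αp * max (Y u ω) 0 - αm * max (-Y u ω) 0 := fun u ω => by
    rw [hX]
    rcases lt_trichotomy (Y u ω) 0 with h | h | h
    · rw [if_neg h.not_gt, if_pos h, max_eq_right h.le, max_eq_left (by linarith)]; ring
    · simp [h]
    · rw [if_pos h, if_neg h.not_gt, max_eq_left h.le, max_eq_right (by linarith)]; ring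
  set φ : ℝ → ℝ := fun y => (αp * max y 0 - αm * max (-y) 0) ^ n - μn with hφdef
  have hφ : Continuous φ := by fun_prop
  obtain ⟨C, hC⟩ : ∃ C : ℝ, ∀ y, |φ y| ≤ C * (1 + |y| ^ n) :=
    exists_growth_bound_oscillating_pow_sub αp αm μn n
  have hφq : ∀ q : ℝ, 1 ≤ q → Integrable (fun y => |φ y| ^ q) (gaussianReal 0 1) :=
    fun q hq => integrable_abs_rpow_gaussianReal hφ hn hC hq
  have hφ1 : Integrable φ (gaussianReal 0 1) := by
    have := hφq 1 le_rfl
    simp only [Real.rpow_one] at this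
    exact (integrable_norm_iff hφ.aestronglyMeasurable).1 this
  have h0 : ∫ y, φ y ∂(gaussianReal 0 1) = 0 := by
    have hi : Integrable (fun y => (αp * max y 0 - αm * max (-y) 0) ^ n) (gaussianReal 0 1) := by
      refine (hφ1.add (integrable_const μn)).congr (ae_of_all _ fun y => ?_)
      simp [hφdef]
    rw [hφdef, integral_sub hi (integrable_const _), integral_gaussian_oscillating_pow _ _ n, hμn]
    simp
  have hlaw : ∀ u, 0 ≤ u → P.map (Y u) = gaussianReal 0 1 := fun u hu => by
    simpa using hGauss u u hu hu 1 0
  have hmain := tendsto_integral_abs_timeAverage_rpow hYmeas hlaw hφ hφq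
    (fun ε hε => exists_abs_covariance_le hYmeas hreven hGauss hrlim hφ hC h0 hε) hp
  refine hmain.congr' ?_
  filter_upwards [eventually_gt_atTop 0] with T hT
  refine integral_congr_ae ?_
  have := isProbabilityMeasure_uniform_Ioc hT
  have hmp := measurePreserving_of_map_eq (P := P) hYmeas ((ae_uniform_Ioc_nonneg T).mono hlaw)
  filter_upwards [(hmp.integrable_comp_of_integrable hφ1).prod_right_ae] with ω hω
  have hXi : Integrable (fun u => X u ω ^ n)
      ((ENNReal.ofReal T)⁻¹ • (volume : Measure ℝ).restrict (Ioc 0 T)) := by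
    refine (hω.add (integrable_const μn)).congr (ae_of_all _ fun u => ?_)
    simp [hφdef, hφX]
  have e : ∀ u, φ (Y u ω) = X u ω ^ n - μn := fun u => by simp [hφdef, hφX]
  simp_rw [e]
  rw [integral_sub hXi (integrable_const _), integral_smul_measure, integral_const]
  simp [hT.le]
end

section
/- Let (Ω, F, P) be a probability space and Y = (Y_t)_{t≥0} a jointly measurable real-valued stochastic process such that there is an even function r : ℝ → ℝ with r(0) = 1 and, for all s, t ≥ 0 and all c, d ∈ ℝ, the random variable c·Y_s + d·Y_t is centered Gaussian with variance c² + d² + 2cd·r(t − s). Assume r(T) → 0 as T → ∞. Let α₊, α₋ > 0 with α₊ ≠ α₋, let X_t = α₊·Y_t·1_{Y_t>0} + α₋·Y_t·1_{Y_t<0}, and define μ̂_i(T) = (1/T)·∫₀^T X_u^i du for i = 1, 2, α̂₊(T) = √(π/2)·μ̂₁(T) + (1/2)·√|4μ̂₂(T) − 2π·μ̂₁(T)²| and α̂₋(T) = −√(π/2)·μ̂₁(T) + (1/2)·√|4μ̂₂(T) − 2π·μ̂₁(T)²|. Then for every p ≥ 1, α̂₊(T) → α₊ and α̂₋(T) →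 α₋ in L^p(P) as T → ∞. -/
open MeasureTheory ProbabilityTheory Real Filter Set

lemma integral_abs_gaussianReal : ∫ x, |x| ∂(gaussianReal 0 1) = √(2 / π) := by
  rw [integral_gaussianReal_eq_integral_smul one_ne_zero]
  have h : ∀ x : ℝ, gaussianPDFReal 0 1 x • |x|
      = (fun y => (√(2 * π))⁻¹ * (y ^ (1 : ℝ) * rexp (-(1 / 2) * y ^ (2 : ℝ)))) |x| := by
    intro x
    simp only [gaussianPDFReal, NNReal.coe_one, mul_one, sub_zero, smul_eq_mul, rpow_one,
      rpow_two, sq_abs]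
    ring_nf
  refine (integral_congr_ae (ae_of_all _ h)).trans ((integral_comp_abs
    (f := fun y => (√(2 * π))⁻¹ * (y ^ (1 : ℝ) * rexp (-(1 / 2) * y ^ (2 : ℝ))))).trans ?_)
  rw [integral_const_mul,
    integral_rpow_mul_exp_neg_mul_rpow (by norm_num) (by norm_num) (by norm_num)]
  norm_num [rpow_neg_one]
  field_simp
  rw [sq_sqrt zero_le_two]

lemma integral_mul_abs_gaussianReal : ∫ x, x * |x| ∂(gaussianReal 0 1) = 0 := by
  have h : ∫ x, x * |x| ∂(gaussianReal 0 1) = -∫ x, x * |x| ∂(gaussianReal 0 1) := by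
    conv_lhs => rw [← neg_zero, ← gaussianReal_map_neg,
      integral_map (by fun_prop) (by fun_prop)]
    simp [integral_neg]
  linarith

lemma integral_sq_gaussianReal : ∫ x, x ^ 2 ∂(gaussianReal 0 1) = 1 := by
  have h := variance_fun_id_gaussianReal (μ := 0) (v := 1)
  rw [variance_of_integral_eq_zero (by fun_prop) integral_id_gaussianReal] at h
  simpa using h

lemma memLp_of_le_one_add_sq {g : ℝ → ℝ} (hg : Continuous g) {C : ℝ}
    (hC : ∀ x, |g x| ≤ C * (1 + x ^ 2)) {p : ENNReal} (hp : p ≠ ⊤) :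
    MemLp g p (gaussianReal 0 1) := by
  have h2 : MemLp (fun x : ℝ => x * x) p (gaussianReal 0 1) :=
    (memLp_id_gaussianReal' (2 * p) (by finiteness)).mul (memLp_id_gaussianReal' (2 * p)
      (by finiteness)) (hpqr := ⟨by
        rw [← two_mul, ENNReal.mul_inv (by simp) (by simp), ← mul_assoc,
          ENNReal.mul_inv_cancel (by simp) (by simp), one_mul]⟩)
  refine (((memLp_const (1 : ℝ)).add h2).const_mul C).of_le hg.aestronglyMeasurable
    (ae_of_all _ fun x => ?_)
  simpa [sq] using (hC x).trans (le_abs_self _)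

/-- A pair all of whose linear combinations are centred Gaussian with the covariance structure of
correlation `ρ` has the law of `(z₁, ρ z₁ + √(1 - ρ²) z₂)` for independent standard normals. -/
lemma map_pair_eq_of_forall_map_linear {Ω : Type*} [MeasurableSpace Ω] {P : Measure Ω}
    [IsProbabilityMeasure P] {U V : Ω → ℝ} (hU : Measurable U) (hV : Measurable V) {ρ : ℝ}
    (hρ : |ρ| ≤ 1)
    (h : ∀ c d : ℝ, P.map (fun ω => c * U ω + d * V ω)
      = gaussianReal 0 (Real.toNNReal (c ^ 2 + d ^ 2 + 2 * c * d * ρ))) :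
    P.map (fun ω => (U ω, V ω)) = ((gaussianReal 0 1).prod (gaussianReal 0 1)).map
      (fun z => (z.1, ρ * z.1 + √(1 - ρ ^ 2) * z.2)) := by
  have : IsProbabilityMeasure (P.map (fun ω => (U ω, V ω))) :=
    Measure.isProbabilityMeasure_map (by fun_prop)
  have hρ2 : 0 ≤ 1 - ρ ^ 2 := by
    have := sq_le_sq' (neg_le_of_abs_le hρ) (le_of_abs_le hρ)
    linarith
  refine Measure.ext_of_charFunDual (funext fun L => ?_)
  have hL : ∀ x y : ℝ, L (x, y) = L (1, 0) * x + L (0, 1) * y := by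
    intro x y
    have : (x, y) = x • ((1 : ℝ), (0 : ℝ)) + y • ((0 : ℝ), (1 : ℝ)) := by simp
    rw [this, map_add, map_smul, map_smul, smul_eq_mul, smul_eq_mul]
    ring
  rw [charFunDual_eq_charFun_map_one, charFunDual_eq_charFun_map_one,
    Measure.map_map (by fun_prop) (by fun_prop), Measure.map_map (by fun_prop) (by fun_prop)]
  congr 1
  have e1 : (⇑L ∘ fun ω => (U ω, V ω)) = fun ω => L (1, 0) * U ω + L (0, 1) * V ω := by
    ext ω; exact hL _ _
  rw [e1, h]
  generalize L (1, 0) = c at hL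
  generalize L (0, 1) = d at hL
  have e2 : (⇑L ∘ fun z : ℝ × ℝ => (z.1, ρ * z.1 + √(1 - ρ ^ 2) * z.2))
      = (fun z => (c + d * ρ) * z.1) + fun z => (d * √(1 - ρ ^ 2)) * z.2 := by
    ext z
    simp only [Function.comp_apply, hL, Pi.add_apply]
    ring
  have hind : IndepFun (fun z : ℝ × ℝ => (c + d * ρ) * z.1)
      (fun z : ℝ × ℝ => (d * √(1 - ρ ^ 2)) * z.2)
      ((gaussianReal 0 1).prod (gaussianReal 0 1)) :=
    indepFun_prod (by fun_prop) (by fun_prop)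
  have h1 : ((gaussianReal 0 1).prod (gaussianReal 0 1)).map
      (fun z : ℝ × ℝ => (c + d * ρ) * z.1) = gaussianReal 0 (NNReal.mk ((c + d * ρ) ^ 2) (sq_nonneg _)) := by
    rw [show (fun z : ℝ × ℝ => (c + d * ρ) * z.1) = (fun x => (c + d * ρ) * x) ∘ Prod.fst from rfl,
      ← Measure.map_map (by fun_prop) (by fun_prop), Measure.map_fst_prod]
    simp [gaussianReal_map_const_mul]
  have h2 : ((gaussianReal 0 1).prod (gaussianReal 0 1)).map
      (fun z : ℝ × ℝ => (d * √(1 - ρ ^ 2)) * z.2)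
        = gaussianReal 0 (NNReal.mk ((d * √(1 - ρ ^ 2)) ^ 2) (sq_nonneg _)) := by
    rw [show (fun z : ℝ × ℝ => (d * √(1 - ρ ^ 2)) * z.2)
        = (fun x => (d * √(1 - ρ ^ 2)) * x) ∘ Prod.snd from rfl,
      ← Measure.map_map (by fun_prop) (by fun_prop), Measure.map_snd_prod]
    simp [gaussianReal_map_const_mul]
  rw [e2, gaussianReal_add_gaussianReal_of_indepFun hind h1 h2]
  congr 1
  · simp
  · ext
    rw [NNReal.coe_add, NNReal.coe_mk, NNReal.coe_mk, mul_pow, sq_sqrt hρ2,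
      Real.coe_toNNReal]
    · ring
    · nlinarith [sq_nonneg (c + d * ρ), mul_nonneg (sq_nonneg d) hρ2]

/-- The correlation of `g(z₁)` and `g` of a `ρ`-correlated normal tends to zero with `ρ`. -/
lemma tendsto_integral_mul_gaussian_correlated {g : ℝ → ℝ} (hg : Continuous g) {C : ℝ}
    (hC : ∀ x, |g x| ≤ C * (1 + x ^ 2)) (h0 : ∫ x, g x ∂(gaussianReal 0 1) = 0) :
    Tendsto (fun ρ : ℝ => ∫ z, g z.1 * g (ρ * z.1 + √(1 - ρ ^ 2) * z.2)
      ∂((gaussianReal 0 1).prod (gaussianReal 0 1))) (nhds 0) (nhds 0) := by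
  have hC0 : 0 ≤ C := by simpa using (abs_nonneg _).trans (hC 0)
  have hlim : ∫ z : ℝ × ℝ, g z.1 * g z.2 ∂((gaussianReal 0 1).prod (gaussianReal 0 1)) = 0 := by
    rw [integral_prod_mul g g, h0, zero_mul]
  conv => arg 3; rw [← hlim]
  have hi1 : Integrable (fun x : ℝ => (1 + x ^ 2) * (1 + 2 * x ^ 2)) (gaussianReal 0 1) := by
    have h4 : Integrable (fun x : ℝ => (1 + x ^ 2) * (1 + x ^ 2)) (gaussianReal 0 1) := by
      have := memLp_of_le_one_add_sq (g := fun x : ℝ => 1 + x ^ 2) (by fun_prop) (C := 1)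
        (fun x => by rw [abs_of_nonneg (by positivity), one_mul]) (p := 2) (by simp)
      exact this.integrable_mul this
    refine (h4.const_mul 2).mono' (by fun_prop) (ae_of_all _ fun x => ?_)
    rw [Real.norm_eq_abs, abs_of_nonneg (by positivity)]
    nlinarith [sq_nonneg x]
  have hi2 : Integrable (fun x : ℝ => 1 + x ^ 2) (gaussianReal 0 1) :=
    memLp_one_iff_integrable.1 (memLp_of_le_one_add_sq (by fun_prop) (C := 1)
      (fun x => by rw [abs_of_nonneg (by positivity), one_mul]) (by simp))
  have hbound : Integrable (fun z : ℝ × ℝ => C ^ 2 * ((1 + z.1 ^ 2) * (1 + 2 * z.1 ^ 2)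
      + (1 + z.1 ^ 2) * (2 * (1 + z.2 ^ 2)))) ((gaussianReal 0 1).prod (gaussianReal 0 1)) :=
    ((hi1.comp_fst _).add (hi2.mul_prod (hi2.const_mul 2))).const_mul _
  refine tendsto_integral_filter_of_dominated_convergence _
    (.of_forall fun ρ => by fun_prop) ?_ hbound (ae_of_all _ fun z => ?_)
  · have hnear : ∀ᶠ ρ : ℝ in nhds 0, |ρ| ≤ 1 := by
      filter_upwards [Metric.closedBall_mem_nhds (0 : ℝ) one_pos] with ρ hρ
      simpa using hρ
    filter_upwards [hnear] with ρ hρ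
    refine ae_of_all _ fun z => ?_
    have hρ2 : ρ ^ 2 ≤ 1 := by
      have := sq_le_sq' (neg_le_of_abs_le hρ) (le_of_abs_le hρ)
      linarith
    have hs : √(1 - ρ ^ 2) ^ 2 = 1 - ρ ^ 2 := sq_sqrt (by linarith)
    have hq : (ρ * z.1 + √(1 - ρ ^ 2) * z.2) ^ 2 ≤ 2 * z.1 ^ 2 + 2 * z.2 ^ 2 := by
      have e : (√(1 - ρ ^ 2) * z.2) ^ 2 = (1 - ρ ^ 2) * z.2 ^ 2 := by rw [mul_pow, hs]
      nlinarith [sq_nonneg (ρ * z.1 - √(1 - ρ ^ 2) * z.2), sq_nonneg z.1, sq_nonneg z.2,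
        sq_nonneg ρ, mul_nonneg (sq_nonneg ρ) (sq_nonneg z.2),
        mul_nonneg (sub_nonneg.2 hρ2) (sq_nonneg z.1)]
    rw [norm_mul, Real.norm_eq_abs, Real.norm_eq_abs]
    calc _ ≤ (C * (1 + z.1 ^ 2)) * (C * (1 + (2 * z.1 ^ 2 + 2 * z.2 ^ 2))) := by
          refine mul_le_mul (hC _) ((hC _).trans ?_) (abs_nonneg _) (by positivity)
          gcongr
      _ ≤ _ := by
          have : 0 ≤ C ^ 2 * (1 + z.1 ^ 2) := by positivity
          nlinarith
  · have hc : Continuous fun ρ : ℝ => g z.1 * g (ρ * z.1 + √(1 - ρ ^ 2) * z.2) := by fun_prop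
    simpa using hc.tendsto 0

lemma lintegral_enorm_integral_rpow_le {α Ω : Type*} [MeasurableSpace α] [MeasurableSpace Ω]
    {ν : Measure α} [IsProbabilityMeasure ν] {P : Measure Ω} [IsProbabilityMeasure P]
    {h : α → Ω → ℝ} (hh : Measurable (Function.uncurry h)) {q : ℝ} (hq : 1 ≤ q) {M : ENNReal}
    (hM : ∀ᵐ u ∂ν, ∫⁻ ω, ‖h u ω‖ₑ ^ q ∂P ≤ M) :
    ∫⁻ ω, ‖∫ u, h u ω ∂ν‖ₑ ^ q ∂P ≤ M := by
  have hq0 : 0 < q := by linarith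
  have hpt : ∀ ω, ‖∫ u, h u ω ∂ν‖ₑ ^ q ≤ ∫⁻ u, ‖h u ω‖ₑ ^ q ∂ν := by
    intro ω
    have hm : AEStronglyMeasurable (fun u => h u ω) ν :=
      (hh.comp (measurable_id.prodMk measurable_const)).aestronglyMeasurable
    have h1 := eLpNorm_le_eLpNorm_of_exponent_le (p := 1) (q := ENNReal.ofReal q)
      (by simpa using hq) hm
    rw [eLpNorm_one_eq_lintegral_enorm, eLpNorm_eq_lintegral_rpow_enorm_toReal
      (by simpa using hq0) (by simp), ENNReal.toReal_ofReal hq0.le, one_div] at h1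
    exact (ENNReal.le_rpow_inv_iff hq0).1 ((enorm_integral_le_lintegral_enorm _).trans h1)
  calc _ ≤ ∫⁻ ω, ∫⁻ u, ‖h u ω‖ₑ ^ q ∂ν ∂P := lintegral_mono hpt
    _ = ∫⁻ u, ∫⁻ ω, ‖h u ω‖ₑ ^ q ∂P ∂ν :=
      lintegral_lintegral_swap (f := fun ω u => ‖h u ω‖ₑ ^ q)
        ((hh.comp measurable_swap).enorm.pow_const q).aemeasurable
    _ ≤ ∫⁻ _, M ∂ν := lintegral_mono_ae hM
    _ = M := by simp

lemma integral_sq_integral_eq_s9 {α Ω : Type*} [MeasurableSpace α] [MeasurableSpace Ω]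
    {ν : Measure α} [IsProbabilityMeasure ν] {P : Measure Ω} [IsProbabilityMeasure P]
    {h : α → Ω → ℝ} (hh : Measurable (Function.uncurry h)) {M : ENNReal} (hMtop : M ≠ ⊤)
    (hM : ∀ᵐ u ∂ν, ∫⁻ ω, ‖h u ω‖ₑ ^ (2 : ℝ) ∂P ≤ M) :
    ∫ ω, (∫ u, h u ω ∂ν) ^ 2 ∂P
      = ∫ z, ∫ ω, h z.1 ω * h z.2 ω ∂P ∂(ν.prod ν) := by
  have hsq : MemLp (fun z : Ω × α => h z.2 z.1) 2 (P.prod ν) := by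
    refine ⟨(hh.comp measurable_swap).aestronglyMeasurable, ?_⟩
    have hm : Measurable fun z : Ω × α => ‖h z.2 z.1‖ₑ ^ (2 : ℝ) :=
      (hh.comp measurable_swap).enorm.pow_const _
    rw [eLpNorm_lt_top_iff_lintegral_rpow_enorm_lt_top (by simp) (by simp), ENNReal.toReal_ofNat,
      lintegral_prod_symm _ hm.aemeasurable]
    calc _ ≤ ∫⁻ _, M ∂ν := lintegral_mono_ae hM
      _ < ⊤ := by simpa using hMtop.lt_top
  have hfst : MemLp (fun x : Ω × α × α => h x.2.1 x.1) 2 (P.prod (ν.prod ν)) :=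
    hsq.comp_measurePreserving ((MeasurePreserving.id P).prod measurePreserving_fst)
  have hsnd : MemLp (fun x : Ω × α × α => h x.2.2 x.1) 2 (P.prod (ν.prod ν)) :=
    hsq.comp_measurePreserving ((MeasurePreserving.id P).prod measurePreserving_snd)
  calc _ = ∫ ω, ∫ z : α × α, h z.1 ω * h z.2 ω ∂(ν.prod ν) ∂P := by
        refine integral_congr_ae (ae_of_all _ fun ω => ?_)
        exact (sq _).trans (integral_prod_mul (fun u => h u ω) (fun u => h u ω)).symm
    _ = _ := integral_integral_swap (f := fun ω z => h (Prod.fst z) ω * h (Prod.snd z) ω)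
      (hfst.integrable_mul hsnd)

lemma abs_integral_mul_le_of_lintegral_sq_le {Ω : Type*} [MeasurableSpace Ω] {P : Measure Ω}
    {U V : Ω → ℝ} (hU : Measurable U) {M : ENNReal} (hMtop : M ≠ ⊤)
    (hUM : ∫⁻ ω, ‖U ω‖ₑ ^ (2 : ℝ) ∂P ≤ M) (hVM : ∫⁻ ω, ‖V ω‖ₑ ^ (2 : ℝ) ∂P ≤ M) :
    |∫ ω, U ω * V ω ∂P| ≤ 2 * M.toReal := by
  have key : ‖∫ ω, U ω * V ω ∂P‖ₑ ≤ 2 * M := by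
    calc _ ≤ ∫⁻ ω, ‖U ω * V ω‖ₑ ∂P := enorm_integral_le_lintegral_enorm _
      _ ≤ ∫⁻ ω, (‖U ω‖ₑ ^ (2 : ℝ) + ‖V ω‖ₑ ^ (2 : ℝ)) ∂P := by
        refine lintegral_mono fun ω => ?_
        rw [enorm_mul, ENNReal.rpow_two, ENNReal.rpow_two]
        rcases le_total ‖U ω‖ₑ ‖V ω‖ₑ with h | h
        · exact (mul_le_mul_left h _).trans (by rw [sq ‖V ω‖ₑ]; exact le_add_self)
        · exact (mul_le_mul_right h _).trans (by rw [sq ‖U ω‖ₑ]; exact le_self_add)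
      _ = ∫⁻ ω, ‖U ω‖ₑ ^ (2 : ℝ) ∂P + ∫⁻ ω, ‖V ω‖ₑ ^ (2 : ℝ) ∂P :=
        lintegral_add_left (hU.enorm.pow_const _) _
      _ ≤ 2 * M := by rw [two_mul]; exact add_le_add hUM hVM
  have := ENNReal.toReal_mono (by finiteness) key
  simpa using this

lemma cond_Ioc_prod_strip_le {T : ℝ} (hT : 0 < T) (L : ℝ) :
    ((cond volume (Ioc 0 T)).prod (cond volume (Ioc 0 T))) {z : ℝ × ℝ | |z.1 - z.2| < L}
      ≤ (ENNReal.ofReal T)⁻¹ * ENNReal.ofReal (2 * L) := by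
  have : IsProbabilityMeasure (cond (volume : Measure ℝ) (Ioc 0 T)) :=
    cond_isProbabilityMeasure_of_finite (by simpa using hT) (by simp)
  have hm : MeasurableSet {z : ℝ × ℝ | |z.1 - z.2| < L} :=
    measurableSet_lt (by fun_prop) (by fun_prop)
  rw [Measure.prod_apply hm]
  calc _ ≤ ∫⁻ _, (ENNReal.ofReal T)⁻¹ * ENNReal.ofReal (2 * L) ∂(cond volume (Ioc 0 T)) := by
        refine lintegral_mono fun u => ?_
        rw [cond_apply measurableSet_Ioc, Real.volume_Ioc, sub_zero, ← Real.volume_ball u L]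
        gcongr
        refine inter_subset_right.trans fun v hv => ?_
        rw [Metric.mem_ball, dist_comm]
        exact hv
    _ = _ := by simp

/-- Second-moment law of large numbers for time averages of an `L²`-bounded process whose
correlations vanish at large time lags. -/
lemma tendsto_integral_sq_timeAverage_s9 {Ω : Type*} [MeasurableSpace Ω] {P : Measure Ω}
    [IsProbabilityMeasure P] {h : ℝ → Ω → ℝ} (hh : Measurable (Function.uncurry h))
    {M : ENNReal} (hMtop : M ≠ ⊤)
    (hM : ∀ u, 0 ≤ u → ∫⁻ ω, ‖h u ω‖ₑ ^ (2 : ℝ) ∂P ≤ M)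
    (hdec : ∀ ε > 0, ∃ L, ∀ u v, 0 ≤ u → 0 ≤ v → L ≤ |u - v| →
      |∫ ω, h u ω * h v ω ∂P| ≤ ε) :
    Tendsto (fun T => ∫ ω, (∫ u, h u ω ∂(cond volume (Ioc 0 T))) ^ 2 ∂P) atTop (nhds 0) := by
  refine tendsto_order.2 ⟨fun a ha => .of_forall fun T => ha.trans_le
    (integral_nonneg fun ω => sq_nonneg _), fun ε hε => ?_⟩
  obtain ⟨L, hL⟩ := hdec (ε / 2) (by positivity)
  set K := 2 * M.toReal
  have hlim : Tendsto (fun T : ℝ => K * ((max (2 * L) 0) / T)) atTop (nhds 0) := by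
    simpa using (tendsto_const_nhds.div_atTop tendsto_id).const_mul K
  filter_upwards [eventually_gt_atTop 0, hlim.eventually_lt_const (half_pos hε)] with T hT hsmall
  set ν := cond (volume : Measure ℝ) (Ioc 0 T)
  have : IsProbabilityMeasure ν :=
    cond_isProbabilityMeasure_of_finite (by simpa using hT) (by simp)
  have hae : ∀ᵐ u ∂ν, 0 ≤ u := by
    filter_upwards [ae_cond_mem measurableSet_Ioc] with u hu using hu.1.le
  rw [integral_sq_integral_eq_s9 hh hMtop (hae.mono hM)]
  set S := {z : ℝ × ℝ | |z.1 - z.2| < L}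
  have hS : MeasurableSet S := measurableSet_lt (by fun_prop) (by fun_prop)
  have hae2 : ∀ᵐ z ∂(ν.prod ν), 0 ≤ z.1 ∧ 0 ≤ z.2 :=
    (Measure.quasiMeasurePreserving_fst.ae hae).and (Measure.quasiMeasurePreserving_snd.ae hae)
  have hint : Integrable (fun z => ε / 2 + S.indicator (fun _ => K) z) (ν.prod ν) :=
    (integrable_const _).add ((integrable_const _).indicator hS)
  have hpt : ∀ᵐ z ∂(ν.prod ν),
      ‖∫ ω, h z.1 ω * h z.2 ω ∂P‖ ≤ ε / 2 + S.indicator (fun _ => K) z := by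
    filter_upwards [hae2] with z hz
    by_cases hzS : z ∈ S
    · rw [indicator_of_mem hzS]
      exact (abs_integral_mul_le_of_lintegral_sq_le (hh.comp measurable_prodMk_left)
        hMtop (hM _ hz.1) (hM _ hz.2)).trans (by linarith)
    · rw [indicator_of_notMem hzS, add_zero]
      exact hL _ _ hz.1 hz.2 (not_lt.1 hzS)
  calc _ ≤ ∫ z, (ε / 2 + S.indicator (fun _ => K) z) ∂(ν.prod ν) :=
        (le_abs_self _).trans (norm_integral_le_of_norm_le hint hpt)
    _ = ε / 2 + K * (ν.prod ν).real S := by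
        rw [integral_add (integrable_const _) ((integrable_const _).indicator hS),
          integral_indicator_const _ hS]
        simp [mul_comm]
    _ ≤ ε / 2 + K * (max (2 * L) 0 / T) := by
        have := ENNReal.toReal_mono (ENNReal.mul_ne_top (by simpa using hT) ENNReal.ofReal_ne_top)
          (cond_Ioc_prod_strip_le hT L)
        rw [ENNReal.toReal_mul, ENNReal.toReal_inv, ENNReal.toReal_ofReal hT.le,
          ENNReal.toReal_ofReal'] at this
        gcongr
        refine this.trans_eq ?_
        rw [div_eq_inv_mul]
    _ < ε := by linarith

lemma integrable_abs_rpow_of_lintegral_lt_top {Ω : Type*} [MeasurableSpace Ω] {P : Measure Ω}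
    {W : Ω → ℝ} (hW : Measurable W) {q : ℝ} (hq : 0 ≤ q)
    (h : ∫⁻ ω, ‖W ω‖ₑ ^ q ∂P < ⊤) : Integrable (fun ω => |W ω| ^ q) P := by
  refine ⟨(hW.abs.pow_const q).aestronglyMeasurable, ?_⟩
  refine lt_of_le_of_lt (le_of_eq (lintegral_congr fun ω => ?_)) h
  rw [Real.enorm_rpow_of_nonneg (abs_nonneg _) hq, ← Real.norm_eq_abs, enorm_norm]

/-- Law of large numbers in every `L^q`, `q ≥ 1`, for time averages of a process which is bounded
in all `L^q` and whose correlations vanish at large time lags. -/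
lemma integrable_and_tendsto_integral_rpow_timeAverage {Ω : Type*} [MeasurableSpace Ω]
    {P : Measure Ω} [IsProbabilityMeasure P] {h : ℝ → Ω → ℝ}
    (hh : Measurable (Function.uncurry h))
    (hM : ∀ q : ℝ, 1 ≤ q → ∃ M : ENNReal, M ≠ ⊤ ∧ ∀ u, 0 ≤ u → ∫⁻ ω, ‖h u ω‖ₑ ^ q ∂P ≤ M)
    (hdec : ∀ ε > 0, ∃ L, ∀ u v, 0 ≤ u → 0 ≤ v → L ≤ |u - v| →
      |∫ ω, h u ω * h v ω ∂P| ≤ ε) {q : ℝ} (hq : 1 ≤ q) :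
    (∀ T > 0, Integrable (fun ω => |∫ u, h u ω ∂(cond volume (Ioc 0 T))| ^ q) P) ∧
    Tendsto (fun T => ∫ ω, |∫ u, h u ω ∂(cond volume (Ioc 0 T))| ^ q ∂P) atTop (nhds 0) := by
  set W : ℝ → Ω → ℝ := fun T ω => ∫ u, h u ω ∂(cond volume (Ioc 0 T))
  have hWm : ∀ T, Measurable (W T) := fun T =>
    (StronglyMeasurable.integral_prod_left' (μ := cond volume (Ioc 0 T))
      (f := Function.uncurry h) hh.stronglyMeasurable).measurable
  have hbdd : ∀ q : ℝ, 1 ≤ q → ∃ M : ENNReal, M ≠ ⊤ ∧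
      ∀ T > 0, ∫⁻ ω, ‖W T ω‖ₑ ^ q ∂P ≤ M := by
    intro q hq
    obtain ⟨M, hMtop, hMq⟩ := hM q hq
    refine ⟨M, hMtop, fun T hT => ?_⟩
    have : IsProbabilityMeasure (cond (volume : Measure ℝ) (Ioc 0 T)) :=
      cond_isProbabilityMeasure_of_finite (by simpa using hT) (by simp)
    refine lintegral_enorm_integral_rpow_le hh hq ?_
    filter_upwards [ae_cond_mem measurableSet_Ioc] with u hu using hMq u hu.1.le
  have hint : ∀ q : ℝ, 1 ≤ q → ∀ T > 0, Integrable (fun ω => |W T ω| ^ q) P := by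
    intro q hq T hT
    obtain ⟨M, hMtop, hMq⟩ := hbdd q hq
    exact integrable_abs_rpow_of_lintegral_lt_top (hWm T) (by linarith)
      ((hMq T hT).trans_lt hMtop.lt_top)
  refine ⟨hint q hq, ?_⟩
  obtain ⟨M2, hM2top, hM2⟩ := hM 2 one_le_two
  have hlim2 := tendsto_integral_sq_timeAverage_s9 hh hM2top hM2 hdec
  obtain ⟨N, hNtop, hN⟩ := hbdd (2 * q) (by linarith)
  refine tendsto_order.2 ⟨fun a ha => .of_forall fun T => ha.trans_le
    (integral_nonneg fun ω => by positivity), fun ε hε => ?_⟩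
  set δ := ε / (1 + N.toReal)
  have hδ : 0 < δ := by positivity
  have hδN : δ / 2 * (1 + N.toReal) = ε / 2 := by
    simp only [δ]; field_simp
  filter_upwards [eventually_gt_atTop 0,
    (hlim2.const_mul (1 / (2 * δ))).eventually_lt_const (u := ε / 2) (by simpa using hε)]
    with T hT hsmall
  have hpt : ∀ ω, |W T ω| ^ q
      ≤ 1 / (2 * δ) * W T ω ^ 2 + δ / 2 * (1 + |W T ω| ^ (2 * q)) := by
    intro ω
    rcases eq_or_lt_of_le (abs_nonneg (W T ω)) with h0 | h0
    · rw [← h0, zero_rpow (by linarith)]; positivity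
    · have e1 : |W T ω| ^ q = |W T ω| * |W T ω| ^ (q - 1) := by
        rw [rpow_sub_one h0.ne']; field_simp
      have e2 : (|W T ω| ^ (q - 1)) ^ 2 ≤ 1 + |W T ω| ^ (2 * q) := by
        rw [← rpow_natCast, ← rpow_mul h0.le]
        rcases le_total |W T ω| 1 with h1 | h1
        · have := rpow_le_one h0.le h1 (z := (q - 1) * (2 : ℕ)) (by push_cast; linarith)
          have := rpow_nonneg h0.le (2 * q)
          linarith
        · have := rpow_le_rpow_of_exponent_le h1
            (show (q - 1) * (2 : ℕ) ≤ 2 * q by push_cast; linarith)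
          linarith
      have e3 : |W T ω| * |W T ω| ^ (q - 1)
          ≤ 1 / (2 * δ) * |W T ω| ^ 2 + δ / 2 * (|W T ω| ^ (q - 1)) ^ 2 := by
        have : 1 / (2 * δ) * |W T ω| ^ 2 + δ / 2 * (|W T ω| ^ (q - 1)) ^ 2
            - |W T ω| * |W T ω| ^ (q - 1)
            = (|W T ω| - δ * |W T ω| ^ (q - 1)) ^ 2 / (2 * δ) := by
          field_simp; ring
        have : 0 ≤ (|W T ω| - δ * |W T ω| ^ (q - 1)) ^ 2 / (2 * δ) := by positivity
        linarith
      rw [e1]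
      rw [sq_abs] at e3
      exact e3.trans (by gcongr)
  have hi2 : Integrable (fun ω => W T ω ^ 2) P := by
    simpa using hint 2 one_le_two T hT
  have hiq := hint (2 * q) (by linarith) T hT
  have hNle : ∫ ω, |W T ω| ^ (2 * q) ∂P ≤ N.toReal := by
    rw [integral_eq_lintegral_of_nonneg_ae (ae_of_all _ fun ω => by positivity)
      hiq.aestronglyMeasurable]
    refine ENNReal.toReal_mono hNtop (le_trans (le_of_eq (lintegral_congr fun ω => ?_)) (hN T hT))
    rw [← Real.enorm_of_nonneg (by positivity),
      Real.enorm_rpow_of_nonneg (abs_nonneg _) (by linarith), ← Real.norm_eq_abs, enorm_norm]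
  calc _ ≤ ∫ ω, (1 / (2 * δ) * W T ω ^ 2 + δ / 2 * (1 + |W T ω| ^ (2 * q))) ∂P :=
        integral_mono (hint q hq T hT)
          ((hi2.const_mul _).add (((integrable_const _).add hiq).const_mul _)) hpt
    _ = 1 / (2 * δ) * ∫ ω, W T ω ^ 2 ∂P + δ / 2 * (1 + ∫ ω, |W T ω| ^ (2 * q) ∂P) := by
        have hi1q : Integrable (fun ω => 1 + |W T ω| ^ (2 * q)) P := (integrable_const _).add hiq
        rw [integral_add (hi2.const_mul _) (hi1q.const_mul _), integral_const_mul,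
          integral_const_mul, integral_add (integrable_const _) hiq]
        simp
    _ ≤ 1 / (2 * δ) * ∫ ω, W T ω ^ 2 ∂P + δ / 2 * (1 + N.toReal) := by gcongr
    _ < ε := by rw [hδN]; linarith

lemma map_eq_gaussianReal_of_map_linear {Ω : Type*} [MeasurableSpace Ω] {P : Measure Ω}
    {Y : ℝ → Ω → ℝ} {r : ℝ → ℝ}
    (hGauss : ∀ s t : ℝ, 0 ≤ s → 0 ≤ t → ∀ c d : ℝ,
      P.map (fun ω => c * Y s ω + d * Y t ω)
        = gaussianReal 0 (Real.toNNReal (c ^ 2 + d ^ 2 + 2 * c * d * r (t - s))))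
    {u : ℝ} (hu : 0 ≤ u) : P.map (Y u) = gaussianReal 0 1 := by
  simpa using hGauss u u hu hu 1 0

lemma exists_forall_abs_integral_mul_le {Ω : Type*} [MeasurableSpace Ω] {P : Measure Ω}
    [IsProbabilityMeasure P] {Y : ℝ → Ω → ℝ} (hY : ∀ t, Measurable (Y t))
    {r : ℝ → ℝ} (hreven : ∀ t, r (-t) = r t)
    (hGauss : ∀ s t : ℝ, 0 ≤ s → 0 ≤ t → ∀ c d : ℝ,
      P.map (fun ω => c * Y s ω + d * Y t ω)
        = gaussianReal 0 (Real.toNNReal (c ^ 2 + d ^ 2 + 2 * c * d * r (t - s))))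
    (hrlim : Tendsto r atTop (nhds 0))
    {g : ℝ → ℝ} (hg : Continuous g) {C : ℝ} (hC : ∀ x, |g x| ≤ C * (1 + x ^ 2))
    (h0 : ∫ x, g x ∂(gaussianReal 0 1) = 0) {ε : ℝ} (hε : 0 < ε) :
    ∃ L, ∀ u v, 0 ≤ u → 0 ≤ v → L ≤ |u - v| → |∫ ω, g (Y u ω) * g (Y v ω) ∂P| ≤ ε := by
  have h1 := hrlim.eventually
    ((tendsto_integral_mul_gaussian_correlated hg hC h0).eventually
      (Metric.closedBall_mem_nhds 0 hε))
  have h2 := hrlim.eventually (Metric.closedBall_mem_nhds 0 one_pos)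
  obtain ⟨L, hL⟩ := eventually_atTop.1 (h1.and h2)
  refine ⟨L, fun u v hu hv huv => ?_⟩
  have hr : r (v - u) = r |u - v| := by
    rcases abs_choice (u - v) with h | h
    · rw [h, ← hreven, neg_sub]
    · rw [h, neg_sub]
  obtain ⟨hcov, hle⟩ := hL _ huv
  rw [← hr] at hcov hle
  have hle : |r (v - u)| ≤ 1 := by simpa using hle
  have hlaw := map_pair_eq_of_forall_map_linear (hY u) (hY v) hle (hGauss u v hu hv)
  have hgm : Continuous fun z : ℝ × ℝ => g z.1 * g z.2 := by fun_prop
  have e : ∫ ω, g (Y u ω) * g (Y v ω) ∂P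
      = ∫ z, g z.1 * g (r (v - u) * z.1 + √(1 - r (v - u) ^ 2) * z.2)
        ∂((gaussianReal 0 1).prod (gaussianReal 0 1)) := by
    rw [← integral_map (φ := fun ω => (Y u ω, Y v ω)) (f := fun z : ℝ × ℝ => g z.1 * g z.2)
      ((hY u).prodMk (hY v)).aemeasurable hgm.aestronglyMeasurable, hlaw,
      integral_map (by fun_prop) hgm.aestronglyMeasurable]
  rw [e]
  simpa using hcov

lemma ae_integrable_of_lintegral_enorm_le {α Ω : Type*} [MeasurableSpace α] [MeasurableSpace Ω]
    {ν : Measure α} [IsProbabilityMeasure ν] {P : Measure Ω} [IsProbabilityMeasure P]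
    {h : α → Ω → ℝ} (hh : Measurable (Function.uncurry h)) {M : ENNReal} (hMtop : M ≠ ⊤)
    (hM : ∀ᵐ u ∂ν, ∫⁻ ω, ‖h u ω‖ₑ ∂P ≤ M) :
    ∀ᵐ ω ∂P, Integrable (fun u => h u ω) ν := by
  have hi : Integrable (fun z : Ω × α => h z.2 z.1) (P.prod ν) := by
    have hm : Measurable fun z : Ω × α => h z.2 z.1 := hh.comp measurable_swap
    refine ⟨hm.aestronglyMeasurable, ?_⟩
    rw [HasFiniteIntegral, lintegral_prod_symm _ hm.enorm.aemeasurable]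
    calc _ ≤ ∫⁻ _, M ∂ν := lintegral_mono_ae hM
      _ < ⊤ := by simpa using hMtop.lt_top
  exact hi.prod_right_ae

/-- `L^q` law of large numbers for time averages of functionals of a stationary Gaussian process
with vanishing correlations. -/
lemma integrable_and_tendsto_timeAverage_gaussian {Ω : Type*} [MeasurableSpace Ω]
    {P : Measure Ω} [IsProbabilityMeasure P]
    {Y : ℝ → Ω → ℝ} (hY : Measurable (Function.uncurry Y))
    {r : ℝ → ℝ} (hreven : ∀ t, r (-t) = r t)
    (hGauss : ∀ s t : ℝ, 0 ≤ s → 0 ≤ t → ∀ c d : ℝ,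
      P.map (fun ω => c * Y s ω + d * Y t ω)
        = gaussianReal 0 (Real.toNNReal (c ^ 2 + d ^ 2 + 2 * c * d * r (t - s))))
    (hrlim : Tendsto r atTop (nhds 0))
    {G : ℝ → ℝ} (hG : Continuous G) {C : ℝ} (hC : ∀ x, |G x| ≤ C * (1 + x ^ 2))
    {e : ℝ} (he : ∫ x, G x ∂(gaussianReal 0 1) = e) {q : ℝ} (hq : 1 ≤ q) :
    (∀ T > 0, Integrable (fun ω => |1 / T * (∫ u in Ioc 0 T, G (Y u ω)) - e| ^ q) P) ∧
    Tendsto (fun T => ∫ ω, |1 / T * (∫ u in Ioc 0 T, G (Y u ω)) - e| ^ q ∂P)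
      atTop (nhds 0) := by
  have hYt : ∀ t, Measurable (Y t) := fun t => hY.comp measurable_prodMk_left
  set g : ℝ → ℝ := fun x => G x - e
  have hg : Continuous g := by fun_prop
  have hgC : ∀ x, |g x| ≤ (C + |e|) * (1 + x ^ 2) := by
    intro x
    have h1 := abs_sub (G x) e
    have h2 := hC x
    have h3 := mul_nonneg (abs_nonneg e) (sq_nonneg x)
    simp only [g]
    linarith
  have hGint : Integrable G (gaussianReal 0 1) :=
    memLp_one_iff_integrable.1 (memLp_of_le_one_add_sq hG hC (by simp))
  have hg0 : ∫ x, g x ∂(gaussianReal 0 1) = 0 := by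
    simp only [g]
    rw [integral_sub hGint (integrable_const _), he]
    simp
  have hh : Measurable (Function.uncurry fun u ω => g (Y u ω)) := hg.measurable.comp hY
  have hM : ∀ q : ℝ, 1 ≤ q → ∃ M : ENNReal, M ≠ ⊤ ∧
      ∀ u, 0 ≤ u → ∫⁻ ω, ‖g (Y u ω)‖ₑ ^ q ∂P ≤ M := by
    intro q hq
    refine ⟨∫⁻ x, ‖g x‖ₑ ^ q ∂(gaussianReal 0 1), ?_, fun u hu => le_of_eq ?_⟩
    · have hmem := memLp_of_le_one_add_sq hg hgC (p := ENNReal.ofReal q) (by simp)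
      have := (eLpNorm_lt_top_iff_lintegral_rpow_enorm_lt_top (by simp; linarith) (by simp)).1
        hmem.2
      rw [ENNReal.toReal_ofReal (by linarith)] at this
      exact this.ne
    · rw [← map_eq_gaussianReal_of_map_linear hGauss hu,
        lintegral_map (hg.measurable.enorm.pow_const q) (hYt u)]
  obtain ⟨hint, hlim⟩ := integrable_and_tendsto_integral_rpow_timeAverage hh hM
    (fun ε hε => exists_forall_abs_integral_mul_le hYt hreven hGauss hrlim hg hgC hg0 hε) hq
  have hae : ∀ T > 0, ∀ᵐ ω ∂P, |∫ u, g (Y u ω) ∂(cond volume (Ioc 0 T))| ^ q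
      = |1 / T * (∫ u in Ioc 0 T, G (Y u ω)) - e| ^ q := by
    intro T hT
    have : IsProbabilityMeasure (cond (volume : Measure ℝ) (Ioc 0 T)) :=
      cond_isProbabilityMeasure_of_finite (by simpa using hT) (by simp)
    obtain ⟨M, hMtop, hM1⟩ := hM 1 le_rfl
    have hM1' : ∀ᵐ u ∂(cond (volume : Measure ℝ) (Ioc 0 T)),
        ∫⁻ ω, ‖g (Y u ω)‖ₑ ∂P ≤ M := by
      filter_upwards [ae_cond_mem measurableSet_Ioc] with u hu
      simpa using hM1 u hu.1.le
    filter_upwards [ae_integrable_of_lintegral_enorm_le hh hMtop hM1'] with ω hω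
    have hωG : Integrable (fun u => G (Y u ω)) (cond volume (Ioc 0 T)) := by
      refine (hω.add (integrable_const e)).congr (ae_of_all _ fun u => ?_)
      simp [g]
    have hscale : ∫ u, G (Y u ω) ∂(cond volume (Ioc 0 T))
        = 1 / T * ∫ u in Ioc 0 T, G (Y u ω) := by
      rw [ProbabilityTheory.cond, integral_smul_measure, Real.volume_Ioc, sub_zero, ENNReal.toReal_inv,
        ENNReal.toReal_ofReal hT.le, smul_eq_mul, one_div]
    simp only [g]
    rw [integral_sub hωG (integrable_const _), hscale]
    simp
  refine ⟨fun T hT => (hint T hT).congr (hae T hT), hlim.congr' ?_⟩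
  filter_upwards [eventually_gt_atTop 0] with T hT
  exact integral_congr_ae (hae T hT)

lemma add_add_rpow_le {a b c p : ℝ} (ha : 0 ≤ a) (hb : 0 ≤ b) (hc : 0 ≤ c) (hp : 0 ≤ p) :
    (a + b + c) ^ p ≤ 3 ^ p * (a ^ p + b ^ p + c ^ p) := by
  have key : ∀ m, 0 ≤ m → a ≤ m → b ≤ m → c ≤ m → (a + b + c) ^ p ≤ 3 ^ p * m ^ p := by
    intro m hm h1 h2 h3
    rw [← mul_rpow (by norm_num) hm]
    exact rpow_le_rpow (by positivity) (by linarith) hp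
  have h3 : (0 : ℝ) ≤ 3 ^ p := by positivity
  have hap := rpow_nonneg ha p
  have hbp := rpow_nonneg hb p
  have hcp := rpow_nonneg hc p
  rcases le_total a b with h | h
  · rcases le_total b c with h' | h'
    · exact (key c hc (h.trans h') h' le_rfl).trans (by gcongr; linarith)
    · exact (key b hb h le_rfl h').trans (by gcongr; linarith)
  · rcases le_total a c with h' | h'
    · exact (key c hc h' (h.trans h') le_rfl).trans (by gcongr; linarith)
    · exact (key a ha le_rfl h h').trans (by gcongr; linarith)

lemma abs_sqrt_abs_sub_le {A s : ℝ} (hs : 0 < s) : |√|A| - s| ≤ |A - s ^ 2| / s := by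
  rw [le_div_iff₀ hs]
  have hsq := sq_sqrt (abs_nonneg A)
  calc |√|A| - s| * s ≤ |√|A| - s| * |√|A| + s| := by
        gcongr
        exact (le_add_of_nonneg_left (sqrt_nonneg _)).trans (le_abs_self _)
    _ = |(|A| - |s ^ 2|)| := by
        rw [← abs_mul, abs_of_nonneg (sq_nonneg s)]
        congr 1
        linear_combination hsq
    _ ≤ |A - s ^ 2| := abs_abs_sub_abs_le _ _

lemma abs_momentEstimator_sub_le {σ s e₁ e₂ : ℝ} (hs : 0 < s)
    (hA : 4 * e₂ - 2 * π * e₁ ^ 2 = s ^ 2) (x y : ℝ) :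
    |σ * x + 1 / 2 * √|4 * y - 2 * π * x ^ 2| - (σ * e₁ + 1 / 2 * s)|
      ≤ (|σ| + (4 + 4 * π * |e₁| + 2 * π) / s) * (|x - e₁| + |y - e₂| + |x - e₁| ^ 2) := by
  have h1 := abs_sqrt_abs_sub_le (A := 4 * y - 2 * π * x ^ 2) hs
  have h2 : |4 * y - 2 * π * x ^ 2 - s ^ 2|
      ≤ (4 + 4 * π * |e₁| + 2 * π) * (|x - e₁| + |y - e₂| + |x - e₁| ^ 2) := by
    have e : 4 * y - 2 * π * x ^ 2 - s ^ 2
        = 4 * (y - e₂) - 4 * π * e₁ * (x - e₁) - 2 * π * (x - e₁) ^ 2 := by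
      rw [← hA]; ring
    rw [e]
    have t := (abs_sub (4 * (y - e₂) - 4 * π * e₁ * (x - e₁)) (2 * π * (x - e₁) ^ 2)).trans
      (add_le_add_left (abs_sub (4 * (y - e₂)) (4 * π * e₁ * (x - e₁))) _)
    simp only [abs_mul, abs_pow, abs_of_pos pi_pos, abs_of_pos (zero_lt_two (α := ℝ)),
      abs_of_pos (zero_lt_four (α := ℝ))] at t
    refine t.trans ?_
    have hπ := pi_pos
    have hx := abs_nonneg (x - e₁)
    have hy := abs_nonneg (y - e₂)
    have he := abs_nonneg e₁
    have : 0 ≤ 4 * (|x - e₁| + |x - e₁| ^ 2) + 4 * π * |e₁| * (|y - e₂| + |x - e₁| ^ 2)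
      + 2 * π * (|x - e₁| + |y - e₂|) := by positivity
    linarith
  set Q := |x - e₁| + |y - e₂| + |x - e₁| ^ 2
  have hQ : |x - e₁| ≤ Q := by
    simp only [Q]
    linarith [abs_nonneg (y - e₂), sq_nonneg |x - e₁|]
  calc _ = |σ * (x - e₁) + 1 / 2 * (√|4 * y - 2 * π * x ^ 2| - s)| := by congr 1; ring
    _ ≤ |σ| * |x - e₁| + 1 / 2 * |√|4 * y - 2 * π * x ^ 2| - s| := by
        refine (abs_add_le _ _).trans_eq ?_
        rw [abs_mul, abs_mul, abs_of_pos (one_half_pos (α := ℝ))]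
    _ ≤ |σ| * Q + (4 + 4 * π * |e₁| + 2 * π) * Q / s := by
        have h3 : |√|4 * y - 2 * π * x ^ 2| - s| ≤ (4 + 4 * π * |e₁| + 2 * π) * Q / s :=
          h1.trans (by gcongr)
        have := abs_nonneg (√|4 * y - 2 * π * x ^ 2| - s)
        have := mul_le_mul_of_nonneg_left hQ (abs_nonneg σ)
        linarith
    _ = _ := by ring

lemma tendsto_integral_abs_rpow_of_le {Ω : Type*} [MeasurableSpace Ω] {P : Measure Ω}
    {a b D : ℝ → Ω → ℝ} {K p : ℝ} (hK : 0 ≤ K) (hp : 0 ≤ p)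
    (hD : ∀ T ω, |D T ω| ≤ K * (|a T ω| + |b T ω| + |a T ω| ^ 2))
    (ha : (∀ T > 0, Integrable (fun ω => |a T ω| ^ p) P) ∧
      Tendsto (fun T => ∫ ω, |a T ω| ^ p ∂P) atTop (nhds 0))
    (hb : (∀ T > 0, Integrable (fun ω => |b T ω| ^ p) P) ∧
      Tendsto (fun T => ∫ ω, |b T ω| ^ p ∂P) atTop (nhds 0))
    (ha2 : (∀ T > 0, Integrable (fun ω => |a T ω| ^ (2 * p)) P) ∧
      Tendsto (fun T => ∫ ω, |a T ω| ^ (2 * p) ∂P) atTop (nhds 0)) :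
    Tendsto (fun T => ∫ ω, |D T ω| ^ p ∂P) atTop (nhds 0) := by
  have hlim := ((ha.2.add hb.2).add ha2.2).const_mul (K ^ p * 3 ^ p)
  simp only [add_zero, mul_zero] at hlim
  refine squeeze_zero' (.of_forall fun T => integral_nonneg fun ω => by positivity) ?_ hlim
  filter_upwards [eventually_gt_atTop 0] with T hT
  have hab : Integrable (fun ω => |a T ω| ^ p + |b T ω| ^ p) P := (ha.1 T hT).add (hb.1 T hT)
  rw [← integral_add (ha.1 T hT) (hb.1 T hT), ← integral_add hab (ha2.1 T hT),
    ← integral_const_mul]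
  refine integral_mono_of_nonneg (ae_of_all _ fun ω => by positivity)
    ((hab.add (ha2.1 T hT)).const_mul _) (ae_of_all _ fun ω => ?_)
  have hsq : |a T ω| ^ (2 * p) = (|a T ω| ^ 2) ^ p := by
    rw [rpow_mul (abs_nonneg _), rpow_two]
  calc |D T ω| ^ p ≤ (K * (|a T ω| + |b T ω| + |a T ω| ^ 2)) ^ p :=
        rpow_le_rpow (abs_nonneg _) (hD T ω) hp
    _ = K ^ p * (|a T ω| + |b T ω| + |a T ω| ^ 2) ^ p := mul_rpow hK (by positivity)
    _ ≤ K ^ p * (3 ^ p * (|a T ω| ^ p + |b T ω| ^ p + (|a T ω| ^ 2) ^ p)) := by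
        gcongr
        exact add_add_rpow_le (abs_nonneg _) (abs_nonneg _) (by positivity) hp
    _ = K ^ p * 3 ^ p * (|a T ω| ^ p + |b T ω| ^ p + |a T ω| ^ (2 * p)) := by
        rw [hsq]; ring

/-- Theorem 3.1 (consistency of the moment estimators): the estimators `α̂₊(T)`, `α̂₋(T)`
built from the first two empirical moments of the oscillating Gaussian process converge
in `L^p` to the true parameters `α₊`, `α₋`. -/
theorem oscillating_gaussian_estimator_consistency
    {Ω : Type*} [MeasurableSpace Ω] (P : Measure Ω) [IsProbabilityMeasure P]
    (Y : ℝ → Ω → ℝ) (hYmeas : Measurable (Function.uncurry Y))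
    (r : ℝ → ℝ) (hreven : ∀ t, r (-t) = r t) (hr0 : r 0 = 1)
    (hGauss : ∀ s t : ℝ, 0 ≤ s → 0 ≤ t → ∀ c d : ℝ,
      P.map (fun ω => c * Y s ω + d * Y t ω)
        = gaussianReal 0 (Real.toNNReal (c ^ 2 + d ^ 2 + 2 * c * d * r (t - s))))
    (hrlim : Tendsto r atTop (nhds 0))
    (αp αm : ℝ) (hαp : 0 < αp) (hαm : 0 < αm) (hne : αp ≠ αm)
    (X : ℝ → Ω → ℝ)
    (hX : ∀ t ω, X t ω = αp * Y t ω * (if 0 < Y t ω then (1 : ℝ) else 0)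
            + αm * Y t ω * (if Y t ω < 0 then (1 : ℝ) else 0))
    (m1 m2 : ℝ → Ω → ℝ)
    (hm1 : ∀ T ω, m1 T ω = (1 / T) * ∫ u in Set.Ioc (0 : ℝ) T, X u ω)
    (hm2 : ∀ T ω, m2 T ω = (1 / T) * ∫ u in Set.Ioc (0 : ℝ) T, (X u ω) ^ 2)
    (aPlus aMinus : ℝ → Ω → ℝ)
    (haPlus : ∀ T ω, aPlus T ω
      = Real.sqrt (π / 2) * m1 T ω
        + (1 / 2) * Real.sqrt |4 * m2 T ω - 2 * π * (m1 T ω) ^ 2|)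
    (haMinus : ∀ T ω, aMinus T ω
      = -Real.sqrt (π / 2) * m1 T ω
        + (1 / 2) * Real.sqrt |4 * m2 T ω - 2 * π * (m1 T ω) ^ 2|)
    (p : ℝ) (hp : 1 ≤ p) :
    Tendsto (fun T : ℝ => ∫ ω, |aPlus T ω - αp| ^ p ∂P) atTop (nhds 0)
    ∧ Tendsto (fun T : ℝ => ∫ ω, |aMinus T ω - αm| ^ p ∂P) atTop (nhds 0) := by
  have hα : 0 < αp + αm := by positivity
  have hXG : ∀ t ω, X t ω = (αp - αm) / 2 * |Y t ω| + (αp + αm) / 2 * Y t ω := by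
    intro t ω
    rw [hX]
    rcases lt_trichotomy (Y t ω) 0 with h | h | h
    · rw [if_neg h.le.not_gt, if_pos h, abs_of_neg h]; ring
    · simp [h]
    · rw [if_pos h, if_neg h.le.not_gt, abs_of_pos h]; ring
  have hXG2 : ∀ t ω, X t ω ^ 2 = (αp ^ 2 + αm ^ 2) / 2 * Y t ω ^ 2
      + (αp ^ 2 - αm ^ 2) / 2 * (Y t ω * |Y t ω|) := by
    intro t ω
    rw [hXG]
    linear_combination (αp - αm) ^ 2 / 4 * sq_abs (Y t ω)
  have habs : Integrable (fun x : ℝ => |x|) (gaussianReal 0 1) :=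
    memLp_one_iff_integrable.1 (memLp_of_le_one_add_sq (by fun_prop) (C := 1)
      (fun x => by rw [abs_abs]; nlinarith [sq_nonneg (|x| - 1), sq_abs x]) (by simp))
  have hid : Integrable (fun x : ℝ => x) (gaussianReal 0 1) :=
    (integrable_norm_iff (by fun_prop)).1 habs
  have hsq : Integrable (fun x : ℝ => x ^ 2) (gaussianReal 0 1) :=
    memLp_one_iff_integrable.1 (memLp_of_le_one_add_sq (by fun_prop) (C := 1)
      (fun x => by rw [abs_of_nonneg (by positivity)]; linarith) (by simp))
  have hmulabs : Integrable (fun x : ℝ => x * |x|) (gaussianReal 0 1) :=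
    memLp_one_iff_integrable.1 (memLp_of_le_one_add_sq (by fun_prop) (C := 1)
      (fun x => by rw [abs_mul, abs_abs, abs_mul_abs_self]; nlinarith) (by simp))
  have he1 : ∫ x, ((αp - αm) / 2 * |x| + (αp + αm) / 2 * x) ∂(gaussianReal 0 1)
      = (αp - αm) / 2 * √(2 / π) := by
    rw [integral_add (habs.const_mul _) (hid.const_mul _), integral_const_mul, integral_const_mul,
      integral_abs_gaussianReal, integral_id_gaussianReal]
    ring
  have he2 : ∫ x, ((αp ^ 2 + αm ^ 2) / 2 * x ^ 2 + (αp ^ 2 - αm ^ 2) / 2 * (x * |x|))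
      ∂(gaussianReal 0 1) = (αp ^ 2 + αm ^ 2) / 2 := by
    rw [integral_add (hsq.const_mul _) (hmulabs.const_mul _), integral_const_mul,
      integral_const_mul, integral_sq_gaussianReal, integral_mul_abs_gaussianReal]
    ring
  have hlln1 : ∀ q : ℝ, 1 ≤ q → _ := fun q hq =>
    integrable_and_tendsto_timeAverage_gaussian hYmeas hreven hGauss hrlim (by fun_prop)
      (C := |(αp - αm) / 2| + |(αp + αm) / 2|) (fun x => by
        refine (abs_add_le _ _).trans ?_
        rw [abs_mul, abs_mul, abs_abs, ← add_mul]
        gcongr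
        nlinarith [sq_nonneg (|x| - 1), sq_abs x]) he1 hq
  have hlln2 : ∀ q : ℝ, 1 ≤ q → _ := fun q hq =>
    integrable_and_tendsto_timeAverage_gaussian hYmeas hreven hGauss hrlim (by fun_prop)
      (C := |(αp ^ 2 + αm ^ 2) / 2| + |(αp ^ 2 - αm ^ 2) / 2|) (fun x => by
        refine (abs_add_le _ _).trans ?_
        rw [abs_mul, abs_mul, abs_mul x, abs_abs, abs_mul_abs_self, abs_pow, sq_abs, ← sq,
          ← add_mul]
        gcongr
        linarith) he2 hq
  simp only [← hXG, ← hXG2, ← hm1, ← hm2] at hlln1 hlln2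
  have hroot : √(π / 2) * √(2 / π) = 1 := by
    rw [← sqrt_mul (by positivity), div_mul_div_comm, mul_comm 2 π, div_self (by positivity),
      sqrt_one]
  have hA : 4 * ((αp ^ 2 + αm ^ 2) / 2) - 2 * π * ((αp - αm) / 2 * √(2 / π)) ^ 2
      = (αp + αm) ^ 2 := by
    rw [mul_pow, sq_sqrt (by positivity)]
    field_simp
    ring
  constructor
  · have hval : √(π / 2) * ((αp - αm) / 2 * √(2 / π)) + 1 / 2 * (αp + αm) = αp := by
      linear_combination (αp - αm) / 2 * hroot
    have hle := fun T ω =>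
      abs_momentEstimator_sub_le (σ := √(π / 2)) hα hA (m1 T ω) (m2 T ω)
    simp only [hval, ← haPlus] at hle
    exact tendsto_integral_abs_rpow_of_le (by positivity) (by linarith) hle
      (hlln1 p hp) (hlln2 p hp) (hlln1 (2 * p) (by linarith))
  · have hval : -√(π / 2) * ((αp - αm) / 2 * √(2 / π)) + 1 / 2 * (αp + αm) = αm := by
      linear_combination -(αp - αm) / 2 * hroot
    have hle := fun T ω =>
      abs_momentEstimator_sub_le (σ := -√(π / 2)) hα hA (m1 T ω) (m2 T ω)
    simp only [hval, ← haMinus] at hle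
    exact tendsto_integral_abs_rpow_of_le (by positivity) (by linarith) hle
      (hlln1 p hp) (hlln2 p hp) (hlln1 (2 * p) (by linarith))
end

section
/- Let r : ℝ → ℝ be a measurable function with |r(t)| ≤ M for all t and some M > 0, and suppose r(t) → 0 as |t| → ∞. Then (1/T²)·∫₀^T ∫₀^T |r(u − s)| du ds → 0 as T → ∞. -/
open MeasureTheory Real Filter Set

/-- If `f` is at most `ε` outside `[-A, A]` and at most `M` everywhere, then integrating a reflected
translate of `f` over `(0, T]` gives at most `ε T + 2 A M`. -/
theorem setIntegral_comp_sub_le_of_le_outside {f : ℝ → ℝ} (hf : Measurable f)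
    (hf0 : ∀ t, 0 ≤ f t) {M ε A T : ℝ} (hfM : ∀ t, f t ≤ M) (hε : 0 ≤ ε) (hA : 0 ≤ A) (hT : 0 ≤ T)
    (hout : ∀ t, A < |t| → f t ≤ ε) (u : ℝ) :
    ∫ s in Ioc (0 : ℝ) T, f (u - s) ≤ ε * T + 2 * A * M := by
  have hM : 0 ≤ M := (hf0 0).trans (hfM 0)
  have hind : Integrable ((Icc (u - A) (u + A)).indicator fun _ => M) :=
    (integrable_indicator_iff measurableSet_Icc).2 (integrableOn_const (by simp))
  have hconst : IntegrableOn (fun _ : ℝ => ε) (Ioc 0 T) := integrableOn_const (by simp)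
  have hint : IntegrableOn (fun s => f (u - s)) (Ioc 0 T) :=
    Measure.integrableOn_of_bounded (M := M) (by simp)
      (hf.comp (measurable_const.sub measurable_id)).aestronglyMeasurable
      (ae_of_all _ fun s => by rw [Real.norm_of_nonneg (hf0 _)]; exact hfM _)
  calc ∫ s in Ioc (0 : ℝ) T, f (u - s)
      ≤ ∫ s in Ioc (0 : ℝ) T, (ε + (Icc (u - A) (u + A)).indicator (fun _ => M) s) := by
        refine setIntegral_mono hint (hconst.add hind.integrableOn) fun s => ?_
        by_cases hs : s ∈ Icc (u - A) (u + A)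
        · simpa [hs] using (hfM (u - s)).trans (le_add_of_nonneg_left hε)
        · simp only [indicator_of_notMem hs, add_zero]
          refine hout _ (not_le.1 fun h => hs ?_)
          rw [abs_le] at h
          exact ⟨by linarith [h.2], by linarith [h.1]⟩
    _ = ε * T + ∫ s in Ioc (0 : ℝ) T, (Icc (u - A) (u + A)).indicator (fun _ => M) s := by
        rw [integral_add hconst hind.integrableOn]
        simp [hT, mul_comm]
    _ ≤ ε * T + ∫ s, (Icc (u - A) (u + A)).indicator (fun _ => M) s := by
        exact add_le_add le_rfl (setIntegral_le_integral hind
          (ae_of_all _ fun s => indicator_nonneg (fun _ _ => hM) s))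
    _ = ε * T + 2 * A * M := by
        rw [integral_indicator measurableSet_Icc, setIntegral_const, smul_eq_mul,
          Real.volume_real_Icc_of_le (by linarith)]
        ring

/-- Key analytic step in the proof of Proposition 3.5: the averaged double integral of a
bounded covariance function vanishing at infinity tends to zero. -/
theorem averaged_double_integral_tendsto_zero
    (r : ℝ → ℝ) (hmeas : Measurable r)
    (M : ℝ) (hM : 0 < M) (hbd : ∀ t, |r t| ≤ M)
    (hlim : Tendsto r (Filter.cocompact ℝ) (nhds 0)) :
    Tendsto (fun T : ℝ =>
        (1 / T ^ 2) * ∫ u in Set.Ioc (0 : ℝ) T, ∫ s in Set.Ioc (0 : ℝ) T, |r (u - s)|)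
      atTop (nhds 0) := by
  rw [Metric.tendsto_nhds]
  intro ε hε
  have hsmall : ∀ᶠ t in cocompact ℝ, |r t| < ε / 2 := by
    simpa [Real.dist_eq] using Metric.tendsto_nhds.1 hlim (ε / 2) (half_pos hε)
  rw [← Metric.cobounded_eq_cocompact] at hsmall
  obtain ⟨B, -, hB⟩ := (Metric.hasBasis_cobounded_compl_closedBall (0 : ℝ)).eventually_iff.1 hsmall
  set A := max B 0
  have hA : 0 ≤ A := le_max_right _ _
  have hout : ∀ t, A < |t| → |r t| ≤ ε / 2 := fun t ht =>
    (hB (by simpa using (le_max_left B 0).trans_lt ht)).le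
  filter_upwards [eventually_gt_atTop 0, eventually_gt_atTop (4 * A * M / ε)] with T hT hTA
  have hinner : ∀ u, ∫ s in Ioc (0 : ℝ) T, |r (u - s)| ≤ ε / 2 * T + 2 * A * M :=
    setIntegral_comp_sub_le_of_le_outside (f := fun t => |r t|) hmeas.abs
      (fun t => abs_nonneg _) hbd (half_pos hε).le hA hT.le hout
  have houter : ‖∫ u in Ioc (0 : ℝ) T, ∫ s in Ioc (0 : ℝ) T, |r (u - s)|‖ ≤
      (ε / 2 * T + 2 * A * M) * T := by
    have := norm_setIntegral_le_of_norm_le_const (μ := volume) (s := Ioc (0 : ℝ) T)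
      (f := fun u => ∫ s in Ioc (0 : ℝ) T, |r (u - s)|) (by simp) fun u _ =>
        (Real.norm_of_nonneg (integral_nonneg fun s => abs_nonneg _)).trans_le (hinner u)
    simpa [hT.le] using this
  rw [div_lt_iff₀ hε] at hTA
  rw [dist_zero_right, norm_mul, Real.norm_of_nonneg (by positivity), one_div,
    inv_mul_lt_iff₀ (by positivity)]
  refine houter.trans_lt ?_
  calc (ε / 2 * T + 2 * A * M) * T < (T * ε) * T := by gcongr; linarith
    _ = T ^ 2 * ε := by ring
end

section
/- Let H ∈ (1/2, 1), let C ∈ ℝ, and let r : (0, ∞) → ℝ be a measurable, locally integrable function with lim_{t→∞} r(t)/t^{2H−2} = C. Then lim_{T→∞} T^{−2H}·∫₀^T r(u)·(T − u) du = C/(2H·(2H − 1)). -/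
open MeasureTheory Real Filter Set

theorem integrableOn_Ioc_rpow {s : ℝ} (hs : -1 < s) {T : ℝ} (hT : 0 ≤ T) :
    IntegrableOn (fun u : ℝ => u ^ s) (Ioc 0 T) :=
  (intervalIntegrable_iff_integrableOn_Ioc_of_le hT).1 (intervalIntegral.intervalIntegrable_rpow' hs)

theorem MeasureTheory.IntegrableOn.mul_const_sub_id {f : ℝ → ℝ} {T : ℝ}
    (hf : IntegrableOn f (Ioc 0 T)) : IntegrableOn (fun u => f u * (T - u)) (Ioc 0 T) := by
  refine Integrable.mul_bdd (c := T) hf (by fun_prop) ?_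
  filter_upwards [ae_restrict_mem measurableSet_Ioc] with u hu
  rw [Real.norm_of_nonneg (by linarith [hu.2])]
  linarith [hu.1]

theorem setIntegral_Ioc_rpow_mul_sub {s : ℝ} (hs : -1 < s) {T : ℝ} (hT : 0 < T) :
    ∫ u in Ioc 0 T, u ^ s * (T - u) = T ^ (s + 2) / ((s + 1) * (s + 2)) := by
  have h_split : ∫ u in Ioc 0 T, u ^ s * (T - u) =
      ∫ u in Ioc 0 T, (T * u ^ s - u ^ (s + 1)) := by
    refine setIntegral_congr_fun measurableSet_Ioc fun u hu => ?_
    simp only [rpow_add_one hu.1.ne']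
    ring
  rw [h_split, integral_sub ((integrableOn_Ioc_rpow hs hT.le).const_mul T)
      (integrableOn_Ioc_rpow (by linarith) hT.le), integral_const_mul,
    ← intervalIntegral.integral_of_le hT.le, ← intervalIntegral.integral_of_le hT.le,
    integral_rpow (Or.inl hs), integral_rpow (Or.inl (by linarith)),
    zero_rpow (by linarith), zero_rpow (by linarith), show s + 2 = s + 1 + 1 by ring,
    rpow_add_one hT.ne' (s + 1)]
  have h₁ : s + 1 ≠ 0 := by linarith
  have h₂ : s + 1 + 1 ≠ 0 := by linarith
  field_simp
  ring

theorem isLittleO_setIntegral_Ioc_mul_sub {s : ℝ} (hs : -1 < s) {g : ℝ → ℝ}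
    (hg : ∀ T : ℝ, 0 < T → IntegrableOn g (Ioc 0 T))
    (h : g =o[atTop] fun u : ℝ => u ^ s) :
    (fun T : ℝ => ∫ u in Ioc 0 T, g u * (T - u)) =o[atTop] fun T : ℝ => T ^ (s + 2) := by
  have hk : 0 < (s + 1) * (s + 2) := mul_pos (by linarith) (by linarith)
  refine Asymptotics.isLittleO_iff.2 fun c hc => ?_
  set ε := c / 2 * ((s + 1) * (s + 2)) with hε
  have hε_pos : 0 < ε := by positivity
  obtain ⟨A, hA⟩ := eventually_atTop.1 (Asymptotics.isLittleO_iff.1 h hε_pos)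
  set B := max A 1
  have hB_pos : 0 < B := lt_of_lt_of_le one_pos (le_max_right _ _)
  set K := ∫ u in Ioc 0 B, |g u|
  filter_upwards [(tendsto_rpow_atTop (show 0 < s + 1 by linarith)).eventually_ge_atTop (2 * K / c),
    eventually_ge_atTop B] with T hT hBT
  have hT_pos : 0 < T := hB_pos.trans_le hBT
  have h_ind : IntegrableOn ((Ioc 0 B).indicator fun u => |g u|) (Ioc 0 T) :=
    ((integrable_indicator_iff measurableSet_Ioc).2 (hg B hB_pos).abs).integrableOn
  have h_rpow := (integrableOn_Ioc_rpow hs hT_pos.le).mul_const_sub_id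
  have h_bound : ∀ u ∈ Ioc 0 T, ‖g u * (T - u)‖ ≤
      (Ioc 0 B).indicator (fun u => |g u|) u * T + ε * (u ^ s * (T - u)) := by
    intro u hu
    have hu_sub : 0 ≤ T - u := by linarith [hu.2]
    have hu_rpow : 0 ≤ u ^ s := rpow_nonneg hu.1.le s
    rw [norm_mul, Real.norm_eq_abs, Real.norm_of_nonneg hu_sub]
    by_cases huB : u ≤ B
    · rw [indicator_of_mem (show u ∈ Ioc 0 B from ⟨hu.1, huB⟩)]
      have h₁ : |g u| * (T - u) ≤ |g u| * T :=
        mul_le_mul_of_nonneg_left (by linarith [hu.1]) (abs_nonneg _)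
      have h₂ : 0 ≤ ε * (u ^ s * (T - u)) := by positivity
      linarith
    · rw [indicator_of_notMem (fun hmem => huB hmem.2), zero_mul, zero_add, ← mul_assoc]
      have h₁ := hA u ((le_max_left A 1).trans (not_le.1 huB).le)
      rw [Real.norm_eq_abs, Real.norm_of_nonneg hu_rpow] at h₁
      exact mul_le_mul_of_nonneg_right h₁ hu_sub
  have h_ind_eq : ∫ u in Ioc 0 T, (Ioc 0 B).indicator (fun u => |g u|) u = K := by
    rw [setIntegral_indicator measurableSet_Ioc,
      inter_eq_self_of_subset_right (Ioc_subset_Ioc_right hBT)]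
  have hKT : K * T ≤ c / 2 * T ^ (s + 2) := by
    rw [div_le_iff₀ hc] at hT
    rw [show s + 2 = s + 1 + 1 by ring, rpow_add_one hT_pos.ne', ← mul_assoc]
    exact mul_le_mul_of_nonneg_right (by linarith) hT_pos.le
  calc ‖∫ u in Ioc 0 T, g u * (T - u)‖
      ≤ ∫ u in Ioc 0 T, ‖g u * (T - u)‖ := norm_integral_le_integral_norm _
    _ ≤ ∫ u in Ioc 0 T,
          ((Ioc 0 B).indicator (fun u => |g u|) u * T + ε * (u ^ s * (T - u))) :=
        setIntegral_mono_on (hg T hT_pos).mul_const_sub_id.norm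
          ((h_ind.mul_const T).add (h_rpow.const_mul ε)) measurableSet_Ioc h_bound
    _ = K * T + ε * (T ^ (s + 2) / ((s + 1) * (s + 2))) := by
        rw [integral_add (h_ind.mul_const T) (h_rpow.const_mul ε), integral_mul_const,
          integral_const_mul, h_ind_eq, setIntegral_Ioc_rpow_mul_sub hs hT_pos]
    _ = K * T + c / 2 * T ^ (s + 2) := by
        rw [hε, mul_assoc, mul_div_cancel₀ _ hk.ne']
    _ ≤ c * ‖T ^ (s + 2)‖ := by
        rw [Real.norm_of_nonneg (rpow_nonneg hT_pos.le _)]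
        linarith

/-- Variance asymptotics under long-range dependence (condition (3) of Assumption 3.1):
if `r(t)/t^{2H-2} → C`, then `T^{-2H} ∫₀^T r(u)(T-u) du → C/(2H(2H-1))`. -/
theorem variance_asymptotics_long_range
    (H : ℝ) (hH : H ∈ Set.Ioo (1 / 2 : ℝ) 1) (C : ℝ)
    (r : ℝ → ℝ) (hmeas : Measurable r)
    (hloc : ∀ T : ℝ, 0 < T → IntegrableOn r (Set.Ioc 0 T))
    (hlim : Tendsto (fun t : ℝ => r t / t ^ (2 * H - 2)) atTop (nhds C)) :
    Tendsto (fun T : ℝ => T ^ (-(2 * H)) * ∫ u in Set.Ioc (0 : ℝ) T, r u * (T - u))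
      atTop (nhds (C / (2 * H * (2 * H - 1)))) := by
  obtain ⟨hH₁, -⟩ := hH
  have hs : -1 < 2 * H - 2 := by linarith
  have h_little : (fun u => r u - C * u ^ (2 * H - 2)) =o[atTop] fun u : ℝ => u ^ (2 * H - 2) := by
    rw [Asymptotics.isLittleO_iff_tendsto' ?_]
    · have h_sub := hlim.sub_const C
      rw [sub_self] at h_sub
      refine h_sub.congr' ?_
      filter_upwards [eventually_gt_atTop 0] with u hu
      rw [sub_div, mul_div_cancel_right₀ _ (rpow_pos_of_pos hu _).ne']
    · filter_upwards [eventually_gt_atTop 0] with u hu h_zero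
      exact absurd h_zero (rpow_pos_of_pos hu _).ne'
  have h_rem := (isLittleO_setIntegral_Ioc_mul_sub hs
    (fun T hT => (hloc T hT).sub ((integrableOn_Ioc_rpow hs hT.le).const_mul C))
    h_little).tendsto_div_nhds_zero.add_const (C / (2 * H * (2 * H - 1)))
  rw [zero_add] at h_rem
  refine h_rem.congr' ?_
  filter_upwards [eventually_gt_atTop 0] with T hT
  have h_split : ∫ u in Ioc 0 T, (r u - C * u ^ (2 * H - 2)) * (T - u) =
      (∫ u in Ioc 0 T, r u * (T - u)) - C * ∫ u in Ioc 0 T, u ^ (2 * H - 2) * (T - u) := by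
    rw [← integral_const_mul, ← integral_sub (hloc T hT).mul_const_sub_id
      ((integrableOn_Ioc_rpow hs hT.le).mul_const_sub_id.const_mul C)]
    congr 1 with u
    ring
  simp only [Pi.sub_apply]
  rw [h_split, setIntegral_Ioc_rpow_mul_sub hs hT, rpow_neg hT.le,
    show 2 * H - 2 + 2 = 2 * H by ring, show 2 * H - 2 + 1 = 2 * H - 1 by ring]
  have h_pow := (rpow_pos_of_pos hT (2 * H)).ne'
  have h₁ : 2 * H - 1 ≠ 0 := by linarith
  have h₂ : H ≠ 0 := by linarith
  field_simp
  ring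
end

section
/- Let C ∈ ℝ and let r : (0, ∞) → ℝ be a measurable, locally integrable function with lim_{t→∞} t·r(t) = C. Then lim_{T→∞} (1/(T·log T))·∫₀^T r(u)·(T − u) du = C. -/
open MeasureTheory Real Filter Set

/-- If `|t * r t - C| ≤ ε` for `t ≥ A ≥ 1`, then `∫₀ᵀ r(u)(T - u) du` differs from `C T log T` by at
most `ε T log T` up to a term linear in `T`. -/
theorem abs_setIntegral_mul_sub_sub_le {C ε A : ℝ} {r : ℝ → ℝ}
    (hloc : ∀ T : ℝ, 0 < T → IntegrableOn r (Set.Ioc 0 T)) (hε : 0 ≤ ε) (hA : 1 ≤ A)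
    (hr : ∀ t, A ≤ t → |t * r t - C| ≤ ε) {T : ℝ} (hT : A ≤ T) :
    |(∫ u in Set.Ioc (0 : ℝ) T, r u * (T - u)) - C * (T * log T)| ≤
      ((∫ u in (0 : ℝ)..A, |r u|) + |C| * (log A + 1)) * T + ε * (T * log T) := by
  have hA0 : 0 < A := by linarith
  have hT0 : 0 < T := by linarith
  have hlogA : 0 ≤ log A := log_nonneg hA
  have hint : ∀ {a b : ℝ}, 0 ≤ a → a ≤ b → 0 < b → IntervalIntegrable r volume a b := by
    intro a b ha hab hb
    exact (intervalIntegrable_iff_integrableOn_Ioc_of_le hab).2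
      ((hloc b hb).mono_set (Ioc_subset_Ioc_left ha))
  have hprod : ∀ {a b : ℝ}, 0 ≤ a → a ≤ b → 0 < b →
      IntervalIntegrable (fun u => r u * (T - u)) volume a b := fun ha hab hb =>
    (hint ha hab hb).mul_continuousOn (by fun_prop)
  have hinv : IntervalIntegrable (fun u : ℝ => u⁻¹) volume A T := by
    refine intervalIntegral.intervalIntegrable_inv (fun x hx => ?_) continuousOn_id
    rw [uIcc_of_le hT] at hx
    exact (hA0.trans_le hx.1).ne'
  have hinv_eq : ∫ u in A..T, u⁻¹ = log T - log A := by
    rw [integral_inv_of_pos hA0 hT0, log_div hT0.ne' hA0.ne']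
  have hmain : IntervalIntegrable (fun u : ℝ => C * (T * u⁻¹ - 1)) volume A T :=
    ((hinv.const_mul T).sub intervalIntegrable_const).const_mul C
  have hmain_eq : ∫ u in A..T, C * (T * u⁻¹ - 1) = C * (T * (log T - log A) - (T - A)) := by
    rw [intervalIntegral.integral_const_mul,
      intervalIntegral.integral_sub (hinv.const_mul T) intervalIntegrable_const,
      intervalIntegral.integral_const_mul, hinv_eq]
    simp
  have hhead : |∫ u in (0 : ℝ)..A, r u * (T - u)| ≤ (∫ u in (0 : ℝ)..A, |r u|) * T := by
    rw [← intervalIntegral.integral_mul_const, ← norm_eq_abs]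
    refine intervalIntegral.norm_integral_le_of_norm_le hA0.le (ae_of_all _ fun u hu => ?_)
      ((hint le_rfl hA0.le hA0).abs.mul_const T)
    rw [norm_mul, norm_eq_abs, norm_eq_abs]
    refine mul_le_mul_of_nonneg_left ?_ (abs_nonneg _)
    rw [abs_of_nonneg (by linarith [hu.2])]
    linarith [hu.1]
  have htail : |∫ u in A..T, (r u * (T - u) - C * (T * u⁻¹ - 1))| ≤
      ε * (T * (log T - log A)) := by
    rw [← hinv_eq, ← intervalIntegral.integral_const_mul, ← intervalIntegral.integral_const_mul,
      ← norm_eq_abs]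
    refine intervalIntegral.norm_integral_le_of_norm_le hT (ae_of_all _ fun u hu => ?_)
      ((hinv.const_mul T).const_mul ε)
    have hu0 : 0 < u := hA0.trans hu.1
    have hfactor : r u * (T - u) - C * (T * u⁻¹ - 1) = (u * r u - C) * ((T - u) * u⁻¹) := by
      field_simp
    rw [hfactor, norm_mul, norm_eq_abs, norm_eq_abs]
    have hquot : 0 ≤ (T - u) * u⁻¹ := mul_nonneg (by linarith [hu.2]) (by positivity)
    rw [abs_of_nonneg hquot]
    refine mul_le_mul (hr u hu.1.le) ?_ hquot hε
    exact mul_le_mul_of_nonneg_right (by linarith) (by positivity)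
  rw [intervalIntegral.integral_sub (hprod hA0.le hT hT0) hmain, hmain_eq] at htail
  rw [← intervalIntegral.integral_of_le hT0.le,
    ← intervalIntegral.integral_add_adjacent_intervals (hprod le_rfl hA0.le hA0)
      (hprod hA0.le hT hT0)]
  set H := ∫ u in (0 : ℝ)..A, r u * (T - u)
  set J := ∫ u in A..T, r u * (T - u)
  have hC : |C * (T * log A + (T - A))| ≤ |C| * (log A + 1) * T := by
    rw [abs_mul, mul_assoc]
    refine mul_le_mul_of_nonneg_left ?_ (abs_nonneg _)
    rw [abs_of_nonneg (by have := mul_nonneg hT0.le hlogA; linarith)]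
    linarith
  have hdecomp : H + J - C * (T * log T) =
      H + (J - C * (T * (log T - log A) - (T - A))) - C * (T * log A + (T - A)) := by ring
  have hdrop : 0 ≤ ε * (T * log A) := by positivity
  rw [hdecomp]
  calc _ ≤ |H| + |J - C * (T * (log T - log A) - (T - A))| + |C * (T * log A + (T - A))| :=
        (abs_sub _ _).trans (add_le_add_left (abs_add_le _ _) _)
    _ ≤ _ := by linarith

/-- Variance asymptotics under the border condition (2) of Assumption 3.1:
if `t·r(t) → C`, then `(1/(T log T)) ∫₀^T r(u)(T-u) du → C`. -/
theorem variance_asymptotics_border_case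
    (C : ℝ) (r : ℝ → ℝ) (hmeas : Measurable r)
    (hloc : ∀ T : ℝ, 0 < T → IntegrableOn r (Set.Ioc 0 T))
    (hlim : Tendsto (fun t : ℝ => t * r t) atTop (nhds C)) :
    Tendsto (fun T : ℝ =>
        (1 / (T * Real.log T)) * ∫ u in Set.Ioc (0 : ℝ) T, r u * (T - u))
      atTop (nhds C) := by
  rw [Metric.tendsto_atTop] at hlim
  rw [Metric.tendsto_nhds]
  intro ε hε
  obtain ⟨N, hN⟩ := hlim (ε / 2) (by positivity)
  obtain ⟨A, hA, hNA⟩ : ∃ A, 1 ≤ A ∧ N ≤ A := ⟨max 1 N, le_max_left _ _, le_max_right _ _⟩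
  set K := (∫ u in (0 : ℝ)..A, |r u|) + |C| * (log A + 1)
  have hK : ∀ᶠ T : ℝ in atTop, K / log T < ε / 2 :=
    (tendsto_log_atTop.const_div_atTop K).eventually_lt_const (by positivity)
  filter_upwards [hK, eventually_ge_atTop A, eventually_gt_atTop 1] with T hKT hAT hT
  have hlog : 0 < log T := log_pos hT
  have hden : 0 < T * log T := by positivity
  have hbound := abs_setIntegral_mul_sub_sub_le hloc (by positivity : 0 ≤ ε / 2) hA
    (fun t ht => (hN t (hNA.trans ht)).le) hAT
  rw [div_lt_iff₀ hlog] at hKT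
  have hlin : K * T < ε / 2 * (T * log T) := by
    have := mul_lt_mul_of_pos_right hKT (by linarith : 0 < T)
    linarith
  have hquot : 1 / (T * log T) * (∫ u in Set.Ioc (0 : ℝ) T, r u * (T - u)) - C =
      ((∫ u in Set.Ioc (0 : ℝ) T, r u * (T - u)) - C * (T * log T)) / (T * log T) := by
    field_simp
  rw [dist_eq, hquot, abs_div, abs_of_pos hden, div_lt_iff₀ hden]
  linarith
end
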